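/- arXiv:1509.01844 — 2 statements merged into one kernel-verified Lean document; each statement's English description precedes it below -/
import Mathlib

section
/- There is a constant C > 0 such that for all integers n, k ≥ 1, every ε ∈ (0,1), and every weighted k-SAT formula Φ over n boolean variables (each clause a disjunction of at most k literals, with nonnegative weights), there exists a reweighted sub-formula Φ_ε consisting of at most C·n·(k + log n)/ε² of the clauses of Φ such that for every truth assignment A, the total weight of clauses of Φ_ε satisfied by A lies within [(1−ε)·W(A), (1+ε)·W(A)], where W(A) is the total weight of clauses of Φ satisfied by A. -/
/-- The value of a truth assignment `A` on a weighted SAT formula with clause set `Φ`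
(each clause a finite set of literals, a literal being a pair of a variable and a
polarity) and weights `w`: the total weight of the satisfied clauses. -/
def satVal {V : Type} [DecidableEq V] (Φ : Finset (Finset (V × Bool)))
    (w : Finset (V × Bool) → ℝ) (A : V → Bool) : ℝ :=
  ∑ c ∈ Φ, if ∃ l ∈ c, A l.1 = l.2 then w c else 0

/-- a hyperedge is cut by a vertex set -/
def hcut {U : Type} (e : Finset U) (S : Set U) : Prop := ∃ a ∈ e, ∃ b ∈ e, a ∈ S ∧ b ∉ S

open Classical in
/-- the edges of `E` cut by `S` -/
noncomputable def dl {I U : Type} (E : Finset I) (e : I → Finset U) (S : Set U) : Finset I :=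
  E.filter (fun i => hcut (e i) S)

/-- vectors constant on all edges -/
def Lsub {I U : Type} (E : Finset I) (e : I → Finset U) : Submodule (ZMod 2) (U → ZMod 2) where
  carrier := {x | ∀ i ∈ E, ∀ a ∈ e i, ∀ b ∈ e i, x a = x b}
  add_mem' := by
    intro x y hx hy i hi a ha b hb
    simp [hx i hi a ha b hb, hy i hi a ha b hb]
  zero_mem' := by
    intro i hi a ha b hb
    rfl
  smul_mem' := by
    intro c x hx i hi a ha b hb
    simp [hx i hi a ha b hb]

lemma rank_step {I U : Type} [Fintype U] [DecidableEq I] (E : Finset I) (e : I → Finset U)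
    (S : Set U) (h : (dl E e S).Nonempty) :
    Module.finrank (ZMod 2) (Lsub E e) < Module.finrank (ZMod 2) (Lsub (E \ dl E e S) e) := by
  classical
  apply Submodule.finrank_lt_finrank_of_lt
  rw [SetLike.lt_iff_le_and_exists]
  constructor
  · intro x hx i hi
    exact hx i (Finset.mem_sdiff.1 hi).1
  · refine ⟨fun v => if v ∈ S then 1 else 0, ?_, ?_⟩
    · intro i hi a ha b hb
      have h1 := Finset.mem_sdiff.1 hi
      have h2 : ¬ hcut (e i) S := fun hc => h1.2 (Finset.mem_filter.2 ⟨h1.1, hc⟩)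
      by_cases haS : a ∈ S <;> by_cases hbS : b ∈ S <;> simp [haS, hbS]
      · exact h2 ⟨a, ha, b, hb, haS, hbS⟩
      · exact h2 ⟨b, hb, a, ha, hbS, haS⟩
    · intro hx
      obtain ⟨i, hi⟩ := h
      obtain ⟨hiE, a, ha, b, hb, haS, hbS⟩ := Finset.mem_filter.1 hi
      have := hx i hiE a ha b hb
      simp [haS, hbS] at this

lemma Lsub_rank_le {I U : Type} [Fintype U] (E : Finset I) (e : I → Finset U) :
    Module.finrank (ZMod 2) (Lsub E e) ≤ Fintype.card U := by
  have := Submodule.finrank_le (Lsub E e)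
  simpa using this

open Classical in
lemma strength {I U : Type} [Fintype U] (e : I → Finset U) (w : I → ℝ) (d : ℕ) :
    ∀ (E : Finset I) (c0 : ℝ), 0 ≤ c0 → (∀ i ∈ E, 0 < w i) → (∀ i ∈ E, ∃ S, hcut (e i) S) →
      Fintype.card U ≤ d + Module.finrank (ZMod 2) (Lsub E e) →
      ∃ κ : I → ℝ, (∀ i ∈ E, c0 ≤ κ i) ∧ (∀ i ∈ E, 0 < κ i) ∧ ∑ i ∈ E, w i / κ i ≤ d ∧
        (E.image κ).card ≤ d ∧
        ∀ t, c0 < t → ∀ S, (dl (E.filter (fun i => t ≤ κ i)) e S).Nonempty →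
          1 ≤ ∑ i ∈ dl (E.filter (fun i => t ≤ κ i)) e S, w i / κ i := by
  induction d with
  | zero =>
    intro E c0 hc0 hw hcut hr
    have hE : E = ∅ := by
      by_contra hne
      obtain ⟨i, hi⟩ := Finset.nonempty_iff_ne_empty.2 hne
      obtain ⟨S, hS⟩ := hcut i hi
      have h1 := rank_step E e S ⟨i, Finset.mem_filter.2 ⟨hi, hS⟩⟩
      have h2 := Lsub_rank_le (E \ dl E e S) e
      omega
    subst hE
    exact ⟨fun _ => 1, by simp, by simp, by simp, by simp, by simp [dl]⟩
  | succ d ih =>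
    intro E c0 hc0 hw hcut hr
    by_cases hE : E = ∅
    · subst hE
      refine ⟨fun _ => 1, by simp, by simp, by simp; positivity, by simp, by simp [dl]⟩
    obtain ⟨i0, hi0⟩ := Finset.nonempty_iff_ne_empty.2 hE
    obtain ⟨S1, hS1⟩ := hcut i0 hi0
    obtain ⟨S0, hS0, hmin⟩ := Finset.exists_min_image
      ((Finset.univ : Finset (Set U)).filter (fun S => (dl E e S).Nonempty))
      (fun S => ∑ i ∈ dl E e S, w i)
      ⟨S1, by simp only [Finset.mem_filter, Finset.mem_univ, true_and]
              exact ⟨i0, Finset.mem_filter.2 ⟨hi0, hS1⟩⟩⟩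
    simp only [Finset.mem_filter, Finset.mem_univ, true_and] at hS0 hmin
    set c := ∑ i ∈ dl E e S0, w i with hc
    have hsub : dl E e S0 ⊆ E := Finset.filter_subset _ _
    have hcpos : 0 < c := Finset.sum_pos (fun i hi => hw i (hsub hi)) hS0
    set c1 := max c0 c with hc1
    have hc1pos : 0 < c1 := lt_of_lt_of_le hcpos (le_max_right _ _)
    have hrs := rank_step E e S0 hS0
    obtain ⟨κ', hk1, hk2, hk3, hk4, hk5⟩ := ih (E \ dl E e S0) c1 hc1pos.le
      (fun i hi => hw i (Finset.mem_sdiff.1 hi).1) (fun i hi => hcut i (Finset.mem_sdiff.1 hi).1)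
      (by omega)
    let κ : I → ℝ := fun i => if i ∈ dl E e S0 then c1 else κ' i
    have hκ1 : ∀ i ∈ dl E e S0, κ i = c1 := fun i hi => by simp [κ, hi]
    have hκ2 : ∀ i ∈ E \ dl E e S0, κ i = κ' i := fun i hi => by
      simp [κ, (Finset.mem_sdiff.1 hi).2]
    have hge : ∀ i ∈ E, c1 ≤ κ i := by
      intro i hi
      by_cases h : i ∈ dl E e S0
      · rw [hκ1 i h]
      · rw [hκ2 i (Finset.mem_sdiff.2 ⟨hi, h⟩)]
        exact hk1 i (Finset.mem_sdiff.2 ⟨hi, h⟩)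
    have key : ∀ t, c1 < t → ∀ S, (dl (E.filter (fun i => t ≤ κ i)) e S).Nonempty →
          1 ≤ ∑ i ∈ dl (E.filter (fun i => t ≤ κ i)) e S, w i / κ i := by
      intro t ht S hne
      have heq : E.filter (fun i => t ≤ κ i) = (E \ dl E e S0).filter (fun i => t ≤ κ' i) := by
        ext i
        simp only [Finset.mem_filter, Finset.mem_sdiff]
        constructor
        · rintro ⟨h1, h2⟩
          have h3 : i ∉ dl E e S0 := by
            intro h
            rw [hκ1 i h] at h2
            linarith
          exact ⟨⟨h1, h3⟩, by rwa [hκ2 i (Finset.mem_sdiff.2 ⟨h1, h3⟩)] at h2⟩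
        · rintro ⟨h1, h2⟩
          exact ⟨h1.1, by rwa [hκ2 i (Finset.mem_sdiff.2 h1)]⟩
      rw [heq] at hne ⊢
      refine (hk5 t ht S hne).trans (le_of_eq ?_)
      refine Finset.sum_congr rfl (fun i hi => ?_)
      rw [hκ2 i (Finset.mem_filter.1 (Finset.mem_filter.1 hi).1).1]
    refine ⟨κ, fun i hi => (le_max_left _ _).trans (hge i hi),
      fun i hi => hc1pos.trans_le (hge i hi), ?_, ?_, ?_⟩
    · rw [← Finset.sum_sdiff hsub]
      have h1 : ∑ i ∈ E \ dl E e S0, w i / κ i ≤ d := by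
        refine le_trans (le_of_eq ?_) hk3
        exact Finset.sum_congr rfl (fun i hi => by rw [hκ2 i hi])
      have h2 : ∑ i ∈ dl E e S0, w i / κ i ≤ 1 := by
        rw [Finset.sum_congr rfl (fun i hi => by rw [hκ1 i hi]), ← Finset.sum_div,
          div_le_one hc1pos]
        exact le_max_right _ _
      push_cast
      linarith
    · have : E.image κ ⊆ insert c1 ((E \ dl E e S0).image κ') := by
        intro x hx
        obtain ⟨i, hi, rfl⟩ := Finset.mem_image.1 hx
        by_cases h : i ∈ dl E e S0
        · rw [hκ1 i h]
          exact Finset.mem_insert_self _ _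
        · have h' := Finset.mem_sdiff.2 ⟨hi, h⟩
          rw [hκ2 i h']
          exact Finset.mem_insert_of_mem (Finset.mem_image_of_mem _ h')
      exact (Finset.card_le_card this).trans ((Finset.card_insert_le _ _).trans (by omega))
    · intro t ht S hne
      by_cases htc : c1 < t
      · exact key t htc S hne
      push Not at htc
      have hfil : E.filter (fun i => t ≤ κ i) = E :=
        Finset.filter_true_of_mem (fun i hi => htc.trans (hge i hi))
      rw [hfil] at hne ⊢
      have hnn : ∀ i ∈ E, 0 ≤ w i / κ i := fun i hi =>
        div_nonneg (hw i hi).le (hc1pos.le.trans (hge i hi))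
      by_cases hex : ∃ i ∈ dl E e S, c1 < κ i
      · obtain ⟨i, hi, hlt⟩ := hex
        have hi' := Finset.mem_filter.1 hi
        refine (key (κ i) hlt S ⟨i, Finset.mem_filter.2
          ⟨Finset.mem_filter.2 ⟨hi'.1, le_rfl⟩, hi'.2⟩⟩).trans ?_
        refine Finset.sum_le_sum_of_subset_of_nonneg ?_ ?_
        · exact Finset.filter_subset_filter _ (Finset.filter_subset _ _)
        · intro j hj _
          exact hnn j (Finset.mem_filter.1 hj).1
      · push Not at hex
        have hcc : c1 = c := by
          rcases max_choice c0 c with h | h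
          · rw [← hc1] at h
            linarith
          · exact h
        have : ∀ i ∈ dl E e S, w i / κ i = w i / c := fun i hi => by
          rw [← hcc, le_antisymm (hex i hi) (hge i (Finset.mem_filter.1 hi).1)]
        rw [Finset.sum_congr rfl this, ← Finset.sum_div, le_div_iff₀ hcpos, one_mul]
        exact hmin S hne

lemma layer {I : Type} (g : I → ℝ) (n : ℕ) : ∀ (D : Finset I) (κ : I → ℝ), D.card ≤ n →
    (∀ i ∈ D, 0 < κ i) →
    (∀ t, 0 < t → 0 ≤ ∑ i ∈ D.filter (fun i => t ≤ κ i), g i) → 0 ≤ ∑ i ∈ D, κ i * g i := by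
  classical
  induction n with
  | zero =>
    intro D κ hD _ _
    have : D = ∅ := by simpa using hD
    simp [this]
  | succ n ih =>
    intro D κ hD hpos h
    by_cases hE : D = ∅
    · simp [hE]
    obtain ⟨i0, hi0, hmin⟩ := Finset.exists_min_image D κ (Finset.nonempty_iff_ne_empty.2 hE)
    have h0 : 0 ≤ ∑ i ∈ D, g i := by
      have := h (κ i0) (hpos i0 hi0)
      rwa [Finset.filter_true_of_mem hmin] at this
    have hsplit : ∑ i ∈ D, κ i * g i = κ i0 * ∑ i ∈ D, g i +
        ∑ i ∈ D.filter (fun i => κ i0 < κ i), (κ i - κ i0) * g i := by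
      rw [Finset.sum_filter_of_ne, Finset.mul_sum, ← Finset.sum_add_distrib]
      · exact Finset.sum_congr rfl (fun i _ => by ring)
      · intro i hi hne
        refine lt_of_le_of_ne (hmin i hi) (fun heq => hne ?_)
        rw [heq]; ring
    rw [hsplit]
    have h2 := ih (D.filter (fun i => κ i0 < κ i)) (fun i => κ i - κ i0) (by
      have : D.filter (fun i => κ i0 < κ i) ⊂ D := by
        rw [Finset.filter_ssubset]
        exact ⟨i0, hi0, by simp⟩
      have := Finset.card_lt_card this
      omega) (by
      intro i hi
      exact sub_pos.2 (Finset.mem_filter.1 hi).2) (by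
      intro t ht
      have h3 := h (t + κ i0) (by linarith [hpos i0 hi0])
      convert h3 using 2
      ext i
      simp only [Finset.mem_filter]
      constructor
      · rintro ⟨⟨a, b⟩, c⟩
        exact ⟨a, by linarith⟩
      · rintro ⟨a, c⟩
        exact ⟨⟨a, by linarith⟩, by linarith⟩)
    have := mul_nonneg (hpos i0 hi0).le h0
    linarith


lemma mgf_bound {I : Type} [DecidableEq I] (E : Finset I) (u : I → ℝ) (hu : ∀ i ∈ E, 0 ≤ u i)
    (Q : ℝ) (hQ : ∑ i ∈ E, u i = Q) (hQ0 : 0 < Q) (m : ℕ) (D : Finset I) (hD : D ⊆ E) (l : ℝ)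
    (hl : |l| ≤ 1) :
    ∑ f ∈ Fintype.piFinset (fun _ : Fin m => E), (∏ j, u (f j) / Q) *
      Real.exp (l * ((Finset.univ.filter (fun j => f j ∈ D)).card : ℝ)) ≤
    Real.exp ((m * (∑ i ∈ D, u i) / Q) * (l + l ^ 2)) := by
  have h1 : ∀ f : Fin m → I, (∏ j, u (f j) / Q) *
      Real.exp (l * ((Finset.univ.filter (fun j => f j ∈ D)).card : ℝ)) =
      ∏ j, (u (f j) / Q * (if f j ∈ D then Real.exp l else 1)) := by
    intro f
    rw [Finset.prod_mul_distrib]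
    congr 1
    rw [← Finset.prod_filter, Finset.prod_const, mul_comm, Real.exp_nat_mul]
  rw [Finset.sum_congr rfl (fun f _ => h1 f),
    Finset.sum_prod_piFinset E (fun _ i => u i / Q * (if i ∈ D then Real.exp l else 1))]
  rw [Finset.prod_const, Finset.card_univ, Fintype.card_fin]
  have h2 : ∑ i ∈ E, u i / Q * (if i ∈ D then Real.exp l else 1) =
      1 + (∑ i ∈ D, u i) / Q * (Real.exp l - 1) := by
    have : ∀ i ∈ E, u i / Q * (if i ∈ D then Real.exp l else 1) =
        u i / Q + (if i ∈ D then u i / Q * (Real.exp l - 1) else 0) := by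
      intro i _
      split_ifs <;> ring
    rw [Finset.sum_congr rfl this, Finset.sum_add_distrib, ← Finset.sum_div, hQ,
      div_self hQ0.ne', ← Finset.sum_filter, Finset.filter_mem_eq_inter,
      Finset.inter_eq_right.2 hD, ← Finset.sum_mul, ← Finset.sum_div]
  have hnn : 0 ≤ ∑ i ∈ E, u i / Q * (if i ∈ D then Real.exp l else 1) := by
    refine Finset.sum_nonneg (fun i hi => ?_)
    have := hu i hi
    split_ifs <;> positivity
  have hp : 0 ≤ (∑ i ∈ D, u i) / Q :=
    div_nonneg (Finset.sum_nonneg (fun i hi => hu i (hD hi))) hQ0.le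
  have h3 : Real.exp l - 1 ≤ l + l ^ 2 := by
    have := (abs_le.1 (Real.abs_exp_sub_one_sub_id_le hl)).2
    linarith
  have h4 : ∑ i ∈ E, u i / Q * (if i ∈ D then Real.exp l else 1) ≤
      Real.exp ((∑ i ∈ D, u i) / Q * (l + l ^ 2)) := by
    rw [h2]
    have h5 := Real.add_one_le_exp ((∑ i ∈ D, u i) / Q * (l + l ^ 2))
    have h6 := mul_le_mul_of_nonneg_left h3 hp
    linarith
  refine (pow_le_pow_left₀ hnn h4 m).trans (le_of_eq ?_)
  rw [← Real.exp_nat_mul]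
  congr 1
  ring

lemma chernoff_exists {I : Type} [DecidableEq I] (E : Finset I) (u : I → ℝ)
    (hu : ∀ i ∈ E, 0 ≤ u i) (Q : ℝ) (hQ : ∑ i ∈ E, u i = Q) (hQ0 : 0 < Q) (m : ℕ) (hm : 0 < m)
    (ε : ℝ) (hε0 : 0 < ε) (hε1 : ε < 1) (F : Finset (Finset I)) (hF : ∀ D ∈ F, D ⊆ E)
    (hsum : ∑ D ∈ F, 2 * Real.exp (-(ε ^ 2 / 4 * (m * (∑ i ∈ D, u i) / Q))) < 1) :
    ∃ f : Fin m → I, (∀ j, f j ∈ E) ∧ ∀ D ∈ F,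
      |Q / m * ((Finset.univ.filter (fun j => f j ∈ D)).card : ℝ) - ∑ i ∈ D, u i|
        ≤ ε * ∑ i ∈ D, u i := by
  by_contra hcon
  push Not at hcon
  let P : (Fin m → I) → ℝ := fun f => ∏ j, u (f j) / Q
  let X : (Fin m → I) → Finset I → ℝ :=
    fun f D => ((Finset.univ.filter (fun j => f j ∈ D)).card : ℝ)
  let μ : Finset I → ℝ := fun D => m * (∑ i ∈ D, u i) / Q
  have hm' : (0 : ℝ) < m := by exact_mod_cast hm
  have hPtot : ∑ f ∈ Fintype.piFinset (fun _ : Fin m => E), P f = 1 := by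
    rw [Finset.sum_prod_piFinset E (fun _ i => u i / Q)]
    rw [← Finset.sum_div, hQ, div_self hQ0.ne']
    simp
  have hPnn : ∀ f ∈ Fintype.piFinset (fun _ : Fin m => E), 0 ≤ P f := by
    intro f hf
    refine Finset.prod_nonneg (fun j _ => div_nonneg (hu _ ?_) hQ0.le)
    exact Fintype.mem_piFinset.1 hf j
  let T : (Fin m → I) → Finset I → ℝ := fun f D =>
    Real.exp (ε / 2 * X f D) * Real.exp (-(ε / 2 * ((1 + ε) * μ D))) +
    Real.exp (-(ε / 2) * X f D) * Real.exp (ε / 2 * ((1 - ε) * μ D))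
  have hone : ∀ f ∈ Fintype.piFinset (fun _ : Fin m => E), 1 ≤ ∑ D ∈ F, T f D := by
    intro f hf
    obtain ⟨D, hDF, hD⟩ := hcon f (Fintype.mem_piFinset.1 hf)
    have hT : ∀ D ∈ F, 0 ≤ T f D := fun D _ => by positivity
    refine le_trans ?_ (Finset.single_le_sum hT hDF)
    have hX : X f D = (m / Q) * (Q / m * X f D) := by
      field_simp
    have hmu : μ D = (m / Q) * ∑ i ∈ D, u i := by simp only [μ]; ring
    have hmQ : 0 < m / Q := by positivity
    rcases lt_abs.1 hD with h | h
    · have h1 : (1 + ε) * μ D ≤ X f D := by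
        rw [hX, hmu]
        have := mul_le_mul_of_nonneg_left h.le hmQ.le
        change _ ≤ (m / Q) * (Q / m * X f D - _) at this
        linarith
      have : 1 ≤ Real.exp (ε / 2 * X f D) * Real.exp (-(ε / 2 * ((1 + ε) * μ D))) := by
        rw [← Real.exp_add]
        apply Real.one_le_exp
        nlinarith
      have h2 : 0 ≤ Real.exp (-(ε / 2) * X f D) * Real.exp (ε / 2 * ((1 - ε) * μ D)) := by
        positivity
      simp only [T]
      linarith
    · have h1 : X f D ≤ (1 - ε) * μ D := by
        rw [hX, hmu]
        have := mul_le_mul_of_nonneg_left h.le hmQ.le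
        change _ ≤ (m / Q) * (-(Q / m * X f D - _)) at this
        linarith
      have : 1 ≤ Real.exp (-(ε / 2) * X f D) * Real.exp (ε / 2 * ((1 - ε) * μ D)) := by
        rw [← Real.exp_add]
        apply Real.one_le_exp
        nlinarith
      have h2 : 0 ≤ Real.exp (ε / 2 * X f D) * Real.exp (-(ε / 2 * ((1 + ε) * μ D))) := by
        positivity
      simp only [T]
      linarith
  have hbig : 1 ≤ ∑ f ∈ Fintype.piFinset (fun _ : Fin m => E), P f * ∑ D ∈ F, T f D := by
    rw [← hPtot]
    refine Finset.sum_le_sum (fun f hf => ?_)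
    exact le_mul_of_one_le_right (hPnn f hf) (hone f hf)
  have hsmall : ∑ f ∈ Fintype.piFinset (fun _ : Fin m => E), P f * ∑ D ∈ F, T f D ≤
      ∑ D ∈ F, 2 * Real.exp (-(ε ^ 2 / 4 * (m * (∑ i ∈ D, u i) / Q))) := by
    rw [Finset.sum_congr rfl (fun f _ => Finset.mul_sum F (T f) (P f)), Finset.sum_comm]
    refine Finset.sum_le_sum (fun D hD => ?_)
    have e1 := mgf_bound E u hu Q hQ hQ0 m D (hF D hD) (ε / 2)
      (by rw [abs_of_pos (by linarith)]; linarith)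
    have e2 := mgf_bound E u hu Q hQ hQ0 m D (hF D hD) (-(ε / 2))
      (by rw [abs_neg, abs_of_pos (by linarith)]; linarith)
    have f1 := mul_le_mul_of_nonneg_right e1 (Real.exp_pos (-(ε / 2 * ((1 + ε) * μ D)))).le
    have f2 := mul_le_mul_of_nonneg_right e2 (Real.exp_pos (ε / 2 * ((1 - ε) * μ D))).le
    rw [← Real.exp_add, Finset.sum_mul] at f1 f2
    have g1 : m * (∑ i ∈ D, u i) / Q * (ε / 2 + (ε / 2) ^ 2) + -(ε / 2 * ((1 + ε) * μ D)) =
      -(ε ^ 2 / 4 * (m * (∑ i ∈ D, u i) / Q)) := by simp only [μ]; ring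
    have g2 : m * (∑ i ∈ D, u i) / Q * (-(ε / 2) + (-(ε / 2)) ^ 2) + ε / 2 * ((1 - ε) * μ D) =
      -(ε ^ 2 / 4 * (m * (∑ i ∈ D, u i) / Q)) := by simp only [μ]; ring
    rw [g1] at f1
    rw [g2] at f2
    have : ∀ f : Fin m → I, P f * T f D =
      (P f * Real.exp (ε / 2 * X f D)) * Real.exp (-(ε / 2 * ((1 + ε) * μ D))) +
      (P f * Real.exp (-(ε / 2) * X f D)) * Real.exp (ε / 2 * ((1 - ε) * μ D)) := by
      intro f
      simp only [T]
      ring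
    rw [Finset.sum_congr rfl (fun f _ => this f), Finset.sum_add_distrib]
    rw [two_mul]
    exact add_le_add f1 f2
  linarith

open Classical in
/-- the cut sets of value at most `α` -/
noncomputable def fam {I U : Type} (E : Finset I) (u : I → ℝ) (α : ℕ) (e : I → Finset U) :
    Finset (Finset I) :=
  E.powerset.filter (fun D => (∃ S, D = dl E e S) ∧ ∑ i ∈ D, u i ≤ α)

lemma mem_fam {I U : Type} {E : Finset I} {u : I → ℝ} {α : ℕ} {e : I → Finset U}
    {D : Finset I} : D ∈ fam E u α e ↔ D ∈ E.powerset ∧ (∃ S, D = dl E e S) ∧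
      ∑ i ∈ D, u i ≤ α := by
  simp [fam]

lemma numeric_step (α j s r : ℕ) (hs : 2 ≤ s) (hsr : s ≤ r) (hj : 2 * α * r < j) (hsj : s ≤ j) :
    ((j - s + 1 : ℕ) : ℝ) ^ (4 * α) ≤ (1 - (α : ℝ) * s / j) * (j : ℝ) ^ (4 * α) := by
  have hj0 : (0 : ℝ) < j := by
    have : 0 < j := by omega
    exact_mod_cast this
  have hs' : (2 : ℝ) ≤ s := by exact_mod_cast hs
  have hsj' : (s : ℝ) ≤ j := by exact_mod_cast hsj
  have h1 : ((j - s + 1 : ℕ) : ℝ) ≤ j * (1 - s / (2 * j)) := by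
    push_cast [Nat.cast_sub hsj]
    have : (j : ℝ) * (1 - s / (2 * j)) = j - s / 2 := by field_simp
    rw [this]
    linarith
  have h2 : 1 - (s : ℝ) / (2 * j) ≤ Real.exp (-(s / (2 * j))) := by
    have := Real.add_one_le_exp (-((s : ℝ) / (2 * j)))
    linarith
  have h3 : ((j - s + 1 : ℕ) : ℝ) ≤ j * Real.exp (-(s / (2 * j))) :=
    h1.trans (mul_le_mul_of_nonneg_left h2 hj0.le)
  have h4 := pow_le_pow_left₀ (Nat.cast_nonneg _) h3 (4 * α)
  refine h4.trans ?_
  rw [mul_pow, mul_comm, ← Real.exp_nat_mul]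
  refine mul_le_mul_of_nonneg_right ?_ (by positivity)
  set x : ℝ := (α : ℝ) * s / j with hx
  have hx0 : 0 ≤ x := by positivity
  have hx1 : x ≤ 1 / 2 := by
    rw [hx, div_le_iff₀ hj0]
    have : (2 : ℝ) * α * r < j := by exact_mod_cast hj
    have h5 : (α : ℝ) * s ≤ α * r :=
      mul_le_mul_of_nonneg_left (by exact_mod_cast hsr) (Nat.cast_nonneg _)
    linarith
  have h6 : ((4 * α : ℕ) : ℝ) * -(s / (2 * j)) = -(2 * x) := by
    rw [hx]; push_cast; field_simp; ring
  rw [h6, Real.exp_neg, inv_le_comm₀ (Real.exp_pos _) (by linarith)]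
  refine le_trans ?_ (Real.add_one_le_exp (2 * x))
  rw [inv_le_comm₀ (by linarith) (by linarith), inv_le_iff_one_le_mul₀ (by linarith)]
  nlinarith

lemma hcut_image {U : Type} [DecidableEq U] (f : U → U) (e : Finset U) (S : Set U) :
    hcut (e.image f) S ↔ hcut e (f ⁻¹' S) := by
  simp [hcut]

lemma hcut_card {U : Type} {e : Finset U} {S : Set U} (h : hcut e S) : 2 ≤ e.card := by
  obtain ⟨a, ha, b, hb, haS, hbS⟩ := h
  have : a ≠ b := fun h => hbS (h ▸ haS)
  exact Finset.one_lt_card.2 ⟨a, ha, b, hb, this⟩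

lemma count_cuts {I U : Type} [DecidableEq I] [DecidableEq U] (E : Finset I) (u : I → ℝ)
    (hu : ∀ i ∈ E, 0 < u i) (α r : ℕ) (n : ℕ) :
    ∀ (X : Finset U) (e : I → Finset U), X.card ≤ n → X.Nonempty → (∀ i ∈ E, e i ⊆ X) →
      (∀ i ∈ E, (e i).card ≤ r) → 
      (∀ S, (dl E e S).Nonempty → 1 ≤ ∑ i ∈ dl E e S, u i) →
      ((fam E u α e).card : ℝ) ≤ 4 ^ (α * r) * (X.card : ℝ) ^ (4 * α) := by
  classical
  induction n with
  | zero =>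
    intro X e hX hne
    have := hne.card_pos
    omega
  | succ n ih =>
    intro X e hXn hne hX hr hmin
    have hj1 : (1 : ℝ) ≤ X.card := by exact_mod_cast hne.card_pos
    by_cases hbase : X.card ≤ 2 * α * r
    · have hsub : fam E u α e ⊆ X.powerset.image (fun S : Finset U => dl E e (S : Set U)) := by
        intro D hD
        obtain ⟨_, ⟨S, rfl⟩, _⟩ := Finset.mem_filter.1 hD
        refine Finset.mem_image.2 ⟨X.filter (fun v => v ∈ S), by simp, ?_⟩
        refine Finset.filter_congr (fun i hi => ?_)
        have := hX i hi
        constructor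
        · rintro ⟨a, ha, b, hb, h1, h2⟩
          refine ⟨a, ha, b, hb, ?_, ?_⟩
          · simp at h1; exact h1.2
          · simp at h2; exact h2 (this hb)
        · rintro ⟨a, ha, b, hb, h1, h2⟩
          refine ⟨a, ha, b, hb, ?_, ?_⟩
          · simp; exact ⟨this ha, h1⟩
          · simp; exact fun _ => h2
      have h1 : (fam E u α e).card ≤ 2 ^ X.card := by
        refine (Finset.card_le_card hsub).trans (Finset.card_image_le.trans ?_)
        rw [Finset.card_powerset]
      have h2 : (fam E u α e).card ≤ 4 ^ (α * r) := by
        refine h1.trans ((Nat.pow_le_pow_right (by norm_num) hbase).trans (le_of_eq ?_))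
        rw [mul_assoc, pow_mul]
        norm_num
      have h3 : ((fam E u α e).card : ℝ) ≤ 4 ^ (α * r) := by exact_mod_cast h2
      refine h3.trans (le_mul_of_one_le_right (by positivity) (one_le_pow₀ hj1))
    push Not at hbase
    by_cases hiso : ∃ v ∈ X, dl E e {v} = ∅
    · obtain ⟨v, hv, hdv⟩ := hiso
      by_cases hX1 : X.card ≤ 1
      · -- a single vertex: only the empty cut
        have hsub : fam E u α e ⊆ {∅} := by
          intro D hD
          obtain ⟨_, ⟨S, rfl⟩, _⟩ := Finset.mem_filter.1 hD
          rw [Finset.mem_singleton]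
          refine Finset.filter_eq_empty_iff.2 (fun i hi hc => ?_)
          have h1 := hcut_card hc
          have h2 := Finset.card_le_card (hX i hi)
          omega
        have h1 := Finset.card_le_card hsub
        have h2 : ((fam E u α e).card : ℝ) ≤ 1 := by exact_mod_cast h1
        refine h2.trans ?_
        have := one_le_pow₀ hj1 (n := 4 * α)
        have h4 : (1 : ℝ) ≤ 4 ^ (α * r) := one_le_pow₀ (by norm_num)
        nlinarith
      have hcard := Finset.card_erase_of_mem hv
      have hcuts : ∀ S, dl E (fun i => (e i).erase v) S = dl E e S := by
        intro S
        refine Finset.filter_congr (fun i hi => ?_)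
        have hnc : ¬ hcut (e i) {v} := fun h => by
          have : i ∈ dl E e {v} := Finset.mem_filter.2 ⟨hi, h⟩
          rw [hdv] at this
          simp at this
        constructor
        · rintro ⟨a, ha, b, hb, h1, h2⟩
          exact ⟨a, Finset.mem_of_mem_erase ha, b, Finset.mem_of_mem_erase hb, h1, h2⟩
        · rintro ⟨a, ha, b, hb, h1, h2⟩
          have hab : a ≠ b := fun h => h2 (h ▸ h1)
          have hva : a ≠ v := by
            rintro rfl
            exact hnc ⟨a, ha, b, hb, rfl, fun h => hab h.symm⟩
          have hvb : b ≠ v := by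
            rintro rfl
            exact hnc ⟨b, hb, a, ha, rfl, fun h => hab h⟩
          exact ⟨a, Finset.mem_erase.2 ⟨hva, ha⟩, b, Finset.mem_erase.2 ⟨hvb, hb⟩, h1, h2⟩
      have hfam : fam E u α (fun i => (e i).erase v) = fam E u α e := by
        unfold fam
        simp_rw [hcuts]
      have := ih (X.erase v) (fun i => (e i).erase v) (by omega)
        (Finset.card_pos.1 (by omega)) (fun i hi => Finset.erase_subset_erase _ (hX i hi))
        (fun i hi => (Finset.card_erase_le).trans (hr i hi))
        (fun S => by rw [hcuts]; exact hmin S)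
      rw [hfam] at this
      refine this.trans ?_
      have : ((X.erase v).card : ℝ) ≤ X.card := by exact_mod_cast Finset.card_erase_le
      gcongr
    · push Not at hiso
      set E2 := E.filter (fun i => 2 ≤ (e i).card) with hE2
      set M := ∑ i ∈ E2, u i with hM
      set j := X.card with hj
      have hj0 : (0 : ℝ) < j := by linarith
      have hdl2 : ∀ S, dl E e S ⊆ E2 := by
        intro S i hi
        have := Finset.mem_filter.1 hi
        exact Finset.mem_filter.2 ⟨this.1, hcut_card this.2⟩
      have hE2E : E2 ⊆ E := Finset.filter_subset _ _
      -- degree count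
      have hdeg : (j : ℝ) ≤ ∑ i ∈ E2, u i * (e i).card := by
        have h1 : (j : ℝ) ≤ ∑ v ∈ X, ∑ i ∈ dl E e {v}, u i := by
          have : (j : ℝ) = ∑ v ∈ X, (1 : ℝ) := by simp [hj]
          rw [this]
          exact Finset.sum_le_sum (fun v hv => hmin {v} (hiso v hv))
        refine h1.trans ?_
        have h2 : ∀ v ∈ X, ∑ i ∈ dl E e {v}, u i ≤ ∑ i ∈ E2, if v ∈ e i then u i else 0 := by
          intro v _
          rw [← Finset.sum_filter]
          refine Finset.sum_le_sum_of_subset_of_nonneg ?_ ?_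
          · intro i hi
            refine Finset.mem_filter.2 ⟨hdl2 _ hi, ?_⟩
            obtain ⟨_, a, ha, b, hb, h1, h2⟩ := Finset.mem_filter.1 hi
            rw [← Set.mem_singleton_iff.1 h1]
            exact ha
          · intro i hi _
            exact (hu i (hE2E (Finset.mem_filter.1 hi).1)).le
        refine (Finset.sum_le_sum h2).trans ?_
        rw [Finset.sum_comm]
        refine Finset.sum_le_sum (fun i hi => ?_)
        rw [← Finset.sum_filter, Finset.sum_const, Finset.filter_mem_eq_inter,
          Finset.inter_eq_right.2 (hX i (hE2E hi)), nsmul_eq_mul, mul_comm]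
      have hMα : (α : ℝ) < M := by
        have h1 : ∑ i ∈ E2, u i * (e i).card ≤ M * r := by
          rw [hM, Finset.sum_mul]
          refine Finset.sum_le_sum (fun i hi => ?_)
          refine mul_le_mul_of_nonneg_left ?_ (hu i (hE2E hi)).le
          exact_mod_cast hr i (hE2E hi)
        have h2 : (2 : ℝ) * α * r < j := by exact_mod_cast hbase
        have hr0 : (0 : ℝ) ≤ r := Nat.cast_nonneg _
        have hα0 : (0 : ℝ) ≤ α := Nat.cast_nonneg _
        by_contra hle
        push Not at hle
        nlinarith [mul_le_mul_of_nonneg_right hle hr0, mul_nonneg hα0 hr0]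
      -- contraction
      have hcontr : ∀ i ∈ E2, (((fam E u α e).filter (fun D => i ∉ D)).card : ℝ) ≤
          4 ^ (α * r) * ((1 - (α : ℝ) * (e i).card / j) * (j : ℝ) ^ (4 * α)) := by
        intro i hi
        have hiE := hE2E hi
        have hs2 : 2 ≤ (e i).card := (Finset.mem_filter.1 hi).2
        obtain ⟨v0, hv0⟩ : (e i).Nonempty := Finset.card_pos.1 (by omega)
        let f : U → U := fun v => if v ∈ e i then v0 else v
        have hsj : (e i).card ≤ j := Finset.card_le_card (hX i hiE)
        have hcuts : ∀ S, dl E (fun k => (e k).image f) S = dl E e (f ⁻¹' S) := by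
          intro S
          exact Finset.filter_congr (fun k _ => hcut_image f (e k) S)
        have hXc : (X.image f).card ≤ j - (e i).card + 1 := by
          have : X.image f ⊆ insert v0 (X \ e i) := by
            intro x hx
            obtain ⟨v, hv, rfl⟩ := Finset.mem_image.1 hx
            by_cases h : v ∈ e i
            · simp [f, h]
            · simp [f, h, hv]
          refine (Finset.card_le_card this).trans ((Finset.card_insert_le _ _).trans ?_)
          rw [Finset.card_sdiff_of_subset (hX i hiE)]
        have hsub : (fam E u α e).filter (fun D => i ∉ D) ⊆
            fam E u α (fun k => (e k).image f) := by
          intro D hD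
          obtain ⟨hD1, hiD⟩ := Finset.mem_filter.1 hD
          obtain ⟨hp, ⟨S, rfl⟩, hα⟩ := Finset.mem_filter.1 hD1
          refine Finset.mem_filter.2 ⟨hp, ⟨S, ?_⟩, hα⟩
          rw [hcuts]
          congr 1
          have hnc : ¬ hcut (e i) S := fun h => hiD (Finset.mem_filter.2 ⟨hiE, h⟩)
          ext v
          by_cases h : v ∈ e i
          · simp only [Set.mem_preimage, f, h, if_true]
            constructor
            · intro h1
              by_contra h2
              exact hnc ⟨v, h, v0, hv0, h1, h2⟩
            · intro h1
              by_contra h2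
              exact hnc ⟨v0, hv0, v, h, h1, h2⟩
          · simp [f, h]
        have h1 := ih (X.image f) (fun k => (e k).image f) (by omega) (hne.image f)
          (fun k hk => Finset.image_subset_image (hX k hk))
          (fun k hk => Finset.card_image_le.trans (hr k hk))
          (fun S => by rw [hcuts]; exact hmin _)
        have h2 : (((fam E u α e).filter (fun D => i ∉ D)).card : ℝ) ≤
            (fam E u α (fun k => (e k).image f)).card := by
          exact_mod_cast Finset.card_le_card hsub
        refine h2.trans (h1.trans ?_)
        refine mul_le_mul_of_nonneg_left ?_ (by positivity)
        refine le_trans ?_ (numeric_step α j (e i).card r hs2 (hr i hiE) hbase hsj)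
        exact pow_le_pow_left₀ (Nat.cast_nonneg _) (by exact_mod_cast hXc) _
      -- double counting
      have hdc : ∑ i ∈ E2, u i * (((fam E u α e).filter (fun D => i ∉ D)).card : ℝ) =
          ∑ D ∈ fam E u α e, (M - ∑ i ∈ D, u i) := by
        have h1 : ∀ i ∈ E2, u i * (((fam E u α e).filter (fun D => i ∉ D)).card : ℝ) =
            ∑ D ∈ fam E u α e, if i ∉ D then u i else 0 := by
          intro i _
          rw [← Finset.sum_filter, Finset.sum_const, nsmul_eq_mul, mul_comm]
        rw [Finset.sum_congr rfl h1, Finset.sum_comm]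
        refine Finset.sum_congr rfl (fun D hD => ?_)
        obtain ⟨_, ⟨S, rfl⟩, _⟩ := Finset.mem_filter.1 hD
        rw [hM, ← Finset.sum_filter, eq_sub_iff_add_eq]
        rw [← Finset.sum_sdiff (hdl2 S)]
        congr 1
        refine Finset.sum_congr ?_ (fun _ _ => rfl)
        ext k
        simp
      have hlow : ((fam E u α e).card : ℝ) * (M - α) ≤
          ∑ D ∈ fam E u α e, (M - ∑ i ∈ D, u i) := by
        rw [← nsmul_eq_mul]
        refine Finset.card_nsmul_le_sum _ _ _ (fun D hD => ?_)
        have := (Finset.mem_filter.1 hD).2.2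
        linarith
      have hup : ∑ i ∈ E2, u i * (((fam E u α e).filter (fun D => i ∉ D)).card : ℝ) ≤
          (4 ^ (α * r) * (j : ℝ) ^ (4 * α)) * (M - α) := by
        have h1 : ∑ i ∈ E2, u i * (((fam E u α e).filter (fun D => i ∉ D)).card : ℝ) ≤
            ∑ i ∈ E2, (4 ^ (α * r) * (j : ℝ) ^ (4 * α)) *
              (u i - α / j * (u i * (e i).card)) := by
          refine Finset.sum_le_sum (fun i hi => ?_)
          refine (mul_le_mul_of_nonneg_left (hcontr i hi) (hu i (hE2E hi)).le).trans
            (le_of_eq ?_)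
          ring
        refine h1.trans ?_
        rw [← Finset.mul_sum, Finset.sum_sub_distrib, ← Finset.mul_sum]
        refine mul_le_mul_of_nonneg_left ?_ (by positivity)
        have h2 : (α : ℝ) / j * j ≤ α / j * ∑ i ∈ E2, u i * (e i).card :=
          mul_le_mul_of_nonneg_left hdeg (by positivity)
        rw [div_mul_cancel₀ _ hj0.ne'] at h2
        linarith
      rw [hdc] at hup
      exact le_of_mul_le_mul_right (hlow.trans hup) (by linarith)

open Classical in
/-- the nonempty cut sets -/
noncomputable def allcuts {I U : Type} (E : Finset I) (e : I → Finset U) : Finset (Finset I) :=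
  E.powerset.filter (fun D => (∃ S, D = dl E e S) ∧ D.Nonempty)

lemma mem_allcuts {I U : Type} {E : Finset I} {e : I → Finset U} {D : Finset I} :
    D ∈ allcuts E e ↔ D ∈ E.powerset ∧ (∃ S, D = dl E e S) ∧ D.Nonempty := by
  simp [allcuts]

lemma sum_cuts {I U : Type} [Fintype U] [Nonempty U] (E : Finset I) (u : I → ℝ)
    (hu : ∀ i ∈ E, 0 < u i) (r : ℕ) (e : I → Finset U) (hr : ∀ i ∈ E, (e i).card ≤ r)
    (hmin : ∀ S, (dl E e S).Nonempty → 1 ≤ ∑ i ∈ dl E e S, u i)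
    (B : ℝ) (hB : B = 4 ^ r * (Fintype.card U : ℝ) ^ 4) (hB2 : 2 ≤ B) (β : ℝ)
    (hβ : β = 3 * Real.log B) :
    ∑ D ∈ allcuts E e, Real.exp (-(β * ∑ i ∈ D, u i)) ≤ 2 / B := by
  classical
  have hB0 : 0 < B := by linarith
  have hβ0 : 0 ≤ β := by
    rw [hβ]
    have := Real.log_nonneg (by linarith : (1 : ℝ) ≤ B)
    linarith
  have hexp : Real.exp (-β) = (B ^ 3)⁻¹ := by
    rw [hβ, Real.exp_neg, ← Nat.cast_ofNat (R := ℝ) (n := 3), Real.exp_nat_mul, Real.exp_log hB0]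
  obtain ⟨T, hT⟩ : ∃ T : ℕ, ∀ D ∈ allcuts E e, ⌊∑ i ∈ D, u i⌋₊ - 1 < T := by
    refine ⟨(allcuts E e).sup (fun D => ⌊∑ i ∈ D, u i⌋₊ - 1) + 1, fun D hD => ?_⟩
    exact Nat.lt_succ_of_le (Finset.le_sup (f := fun D => ⌊∑ i ∈ D, u i⌋₊ - 1) hD)
  rw [← Finset.sum_fiberwise_of_maps_to (g := fun D => ⌊∑ i ∈ D, u i⌋₊ - 1)
    (t := Finset.range T) (fun D hD => Finset.mem_range.2 (hT D hD))]
  have hlev : ∀ a ∈ Finset.range T,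
      ∑ D ∈ (allcuts E e).filter (fun D => ⌊∑ i ∈ D, u i⌋₊ - 1 = a),
        Real.exp (-(β * ∑ i ∈ D, u i)) ≤ B⁻¹ * (B⁻¹) ^ a := by
    intro a _
    have hval : ∀ D ∈ (allcuts E e).filter (fun D => ⌊∑ i ∈ D, u i⌋₊ - 1 = a),
        ((a + 1 : ℕ) : ℝ) ≤ ∑ i ∈ D, u i ∧ D ∈ fam E u (a + 2) e := by
      intro D hD
      obtain ⟨hD1, hDa⟩ := Finset.mem_filter.1 hD
      obtain ⟨hp, ⟨S, rfl⟩, hne⟩ := mem_allcuts.1 hD1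
      have h1 := hmin S hne
      have h2 : 1 ≤ ⌊∑ i ∈ dl E e S, u i⌋₊ := Nat.le_floor (by simpa using h1)
      have h3 : ⌊∑ i ∈ dl E e S, u i⌋₊ = a + 1 := by omega
      have h4 := Nat.floor_le (zero_le_one.trans h1)
      have h5 := Nat.lt_floor_add_one (∑ i ∈ dl E e S, u i)
      rw [h3] at h4 h5
      refine ⟨h4, mem_fam.2 ⟨hp, ⟨S, rfl⟩, ?_⟩⟩
      push_cast at h5 ⊢
      linarith
    have hcard : (((allcuts E e).filter (fun D => ⌊∑ i ∈ D, u i⌋₊ - 1 = a)).card : ℝ) ≤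
        B ^ (a + 2) := by
      have h1 : (((allcuts E e).filter (fun D => ⌊∑ i ∈ D, u i⌋₊ - 1 = a)).card : ℝ) ≤
          (fam E u (a + 2) e).card := by
        exact_mod_cast Finset.card_le_card (fun D hD => (hval D hD).2)
      have h2 := count_cuts E u hu (a + 2) r _ Finset.univ e le_rfl Finset.univ_nonempty
        (fun i _ => Finset.subset_univ _) hr hmin
      refine h1.trans (h2.trans (le_of_eq ?_))
      rw [hB, mul_pow, ← pow_mul, ← pow_mul, Finset.card_univ, mul_comm r]
    have hterm : ∀ D ∈ (allcuts E e).filter (fun D => ⌊∑ i ∈ D, u i⌋₊ - 1 = a),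
        Real.exp (-(β * ∑ i ∈ D, u i)) ≤ ((B ^ 3)⁻¹) ^ (a + 1) := by
      intro D hD
      rw [← hexp, ← Real.exp_nat_mul]
      apply Real.exp_le_exp.2
      have := mul_le_mul_of_nonneg_left (hval D hD).1 hβ0
      linarith
    refine (Finset.sum_le_card_nsmul _ _ _ hterm).trans ?_
    rw [nsmul_eq_mul]
    refine (mul_le_mul_of_nonneg_right hcard (by positivity)).trans ?_
    rw [← pow_succ', inv_pow, inv_pow, ← div_eq_mul_inv, div_le_iff₀ (by positivity),
      ← div_eq_inv_mul, le_div_iff₀ (by positivity), ← pow_add, ← pow_mul]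
    exact pow_le_pow_right₀ (by linarith) (by omega)
  refine (Finset.sum_le_sum hlev).trans ?_
  rw [← Finset.mul_sum]
  have hq : B⁻¹ ≤ 1 / 2 := by
    rw [one_div]
    exact inv_anti₀ (by norm_num) hB2
  have hq0 : 0 ≤ B⁻¹ := by positivity
  have hgeo : ∑ a ∈ Finset.range T, (B⁻¹) ^ a ≤ 2 := by
    have h1 : ∑ a ∈ Finset.range T, (B⁻¹) ^ a ≤ ∑ a ∈ Finset.range T, (1 / 2 : ℝ) ^ a :=
      Finset.sum_le_sum (fun a _ => pow_le_pow_left₀ hq0 hq a)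
    exact h1.trans (sum_geometric_two_le T)
  rw [div_eq_inv_mul]
  exact mul_le_mul_of_nonneg_left hgeo hq0

lemma sum_biUnion_le' {α β : Type} [DecidableEq β] (s : Finset α) (t : α → Finset β)
    (g : β → ℝ) (hg : ∀ b, 0 ≤ g b) :
    ∑ b ∈ s.biUnion t, g b ≤ ∑ a ∈ s, ∑ b ∈ t a, g b := by
  classical
  induction s using Finset.induction_on with
  | empty => simp
  | insert a s ha ih =>
    rw [Finset.biUnion_insert, Finset.sum_insert ha]
    have h1 := Finset.sum_union_inter (s₁ := t a) (s₂ := s.biUnion t) (f := g)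
    have h2 : 0 ≤ ∑ b ∈ t a ∩ s.biUnion t, g b := Finset.sum_nonneg (fun b _ => hg b)
    linarith

open Classical in
lemma satVal_eq {V : Type} [DecidableEq V] (Φ : Finset (Finset (V × Bool)))
    (w : Finset (V × Bool) → ℝ) (A : V → Bool) :
    satVal Φ w A = ∑ c ∈ Φ.filter (fun c => ∃ l ∈ c, A l.1 = l.2), w c := by
  rw [satVal, Finset.sum_filter]

lemma hcut_clause {V : Type} [DecidableEq V] (c : Finset (V × Bool)) (A : V → Bool) :
    hcut (insert none (c.image some)) {x | ∃ l, x = some l ∧ A l.1 = l.2} ↔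
      ∃ l ∈ c, A l.1 = l.2 := by
  constructor
  · rintro ⟨a, ha, b, hb, ⟨l, rfl, hl⟩, h2⟩
    simp at ha
    exact ⟨l, ha, hl⟩
  · rintro ⟨l, hl, hA⟩
    refine ⟨some l, by simp [hl], none, by simp, ⟨l, rfl, hA⟩, ?_⟩
    rintro ⟨l', h, _⟩
    cases h

open Classical in
/-- Hypergraph cut sparsification. -/
lemma hyper_sparsify {I U : Type} [Fintype U] (hU : 3 ≤ Fintype.card U) (E : Finset I)
    (hE : E.Nonempty) (w : I → ℝ) (hw : ∀ i ∈ E, 0 < w i) (r : ℕ) (e : I → Finset U)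
    (hr : ∀ i ∈ E, (e i).card ≤ r) (hcut' : ∀ i ∈ E, ∃ S, hcut (e i) S)
    (ε : ℝ) (hε0 : 0 < ε) (hε1 : ε < 1) (m : ℕ)
    (hm : 12 * Real.log (4 ^ r * (Fintype.card U : ℝ) ^ 4) * Fintype.card U / ε ^ 2 ≤ m) :
    ∃ (E' : Finset I) (w' : I → ℝ), E' ⊆ E ∧ (∀ i ∈ E', 0 ≤ w' i) ∧ E'.card ≤ m ∧
      ∀ S, (1 - ε) * ∑ i ∈ dl E e S, w i ≤ ∑ i ∈ dl E' e S, w' i ∧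
        ∑ i ∈ dl E' e S, w' i ≤ (1 + ε) * ∑ i ∈ dl E e S, w i := by
  have hUne : Nonempty U := Fintype.card_pos_iff.1 (by omega)
  obtain ⟨κ, -, hκ, hQle, hlev, hstr⟩ := strength e w (Fintype.card U) E 0 le_rfl hw hcut'
    (Nat.le_add_right _ _)
  set N : ℝ := (Fintype.card U : ℝ) with hN
  have hN3 : 3 ≤ N := by rw [hN]; exact_mod_cast hU
  set u : I → ℝ := fun i => w i / κ i with hudef
  have hu : ∀ i ∈ E, 0 < u i := fun i hi => div_pos (hw i hi) (hκ i hi)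
  set Q := ∑ i ∈ E, u i with hQ
  have hQ0 : 0 < Q := Finset.sum_pos hu hE
  set B : ℝ := 4 ^ r * N ^ 4 with hB
  have h4r : (1 : ℝ) ≤ 4 ^ r := one_le_pow₀ (by norm_num)
  have hN4 : 27 * N ≤ N ^ 4 := by
    have : (3 : ℝ) ^ 3 ≤ N ^ 3 := pow_le_pow_left₀ (by norm_num) hN3 3
    nlinarith
  have hBN : 27 * N ≤ B := by
    rw [hB]
    nlinarith
  have hB0 : 0 < B := by linarith
  have hlogB : 0 < Real.log B := Real.log_pos (by linarith)
  have hm0 : 0 < m := by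
    have : (0 : ℝ) < m := lt_of_lt_of_le (by positivity) hm
    exact_mod_cast this
  have hm0' : (0 : ℝ) < m := by exact_mod_cast hm0
  let Et : ℝ → Finset I := fun t => E.filter (fun i => t ≤ κ i)
  let F : Finset (Finset I) := (E.image κ).biUnion (fun t => allcuts (Et t) e)
  have hEt : ∀ t, Et t ⊆ E := fun t => Finset.filter_subset _ _
  have hFE : ∀ D ∈ F, D ⊆ E := by
    intro D hD
    obtain ⟨t, -, ht⟩ := Finset.mem_biUnion.1 hD
    exact (Finset.mem_powerset.1 (mem_allcuts.1 ht).1).trans (hEt t)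
  have hsum : ∑ D ∈ F, 2 * Real.exp (-(ε ^ 2 / 4 * (m * (∑ i ∈ D, u i) / Q))) < 1 := by
    have h1 : ∀ D ∈ F, 2 * Real.exp (-(ε ^ 2 / 4 * (m * (∑ i ∈ D, u i) / Q))) ≤
        2 * Real.exp (-(3 * Real.log B * ∑ i ∈ D, u i)) := by
      intro D hD
      have hD0 : 0 ≤ ∑ i ∈ D, u i := Finset.sum_nonneg (fun i hi => (hu i (hFE D hD hi)).le)
      have h2 : 3 * Real.log B ≤ ε ^ 2 / 4 * (m / Q) := by
        rw [div_le_iff₀ (by positivity)] at hm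
        rw [← mul_div_assoc, le_div_iff₀ hQ0]
        have : 3 * Real.log B * Q ≤ 3 * Real.log B * N :=
          mul_le_mul_of_nonneg_left hQle (by positivity)
        linarith
      have h3 := mul_le_mul_of_nonneg_right h2 hD0
      have h4 : ε ^ 2 / 4 * (m * (∑ i ∈ D, u i) / Q) =
        ε ^ 2 / 4 * (m / Q) * ∑ i ∈ D, u i := by ring
      rw [h4]
      have := Real.exp_le_exp.2 (neg_le_neg h3)
      linarith
    refine lt_of_le_of_lt (Finset.sum_le_sum h1) ?_
    rw [← Finset.mul_sum]
    have h2 : ∑ D ∈ F, Real.exp (-(3 * Real.log B * ∑ i ∈ D, u i)) ≤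
        ∑ t ∈ E.image κ, ∑ D ∈ allcuts (Et t) e,
          Real.exp (-(3 * Real.log B * ∑ i ∈ D, u i)) := by
      exact sum_biUnion_le' _ _ _ (fun _ => (Real.exp_pos _).le)
    have h3 : ∀ t ∈ E.image κ, ∑ D ∈ allcuts (Et t) e,
          Real.exp (-(3 * Real.log B * ∑ i ∈ D, u i)) ≤ 2 / B := by
      intro t ht
      obtain ⟨i, hi, rfl⟩ := Finset.mem_image.1 ht
      exact sum_cuts (Et (κ i)) u (fun k hk => hu k (hEt _ hk)) r e
        (fun k hk => hr k (hEt _ hk)) (hstr (κ i) (hκ i hi)) B hB (by linarith) _ rfl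
    have h4 := Finset.sum_le_card_nsmul _ _ _ h3
    rw [nsmul_eq_mul] at h4
    have h5 : ((E.image κ).card : ℝ) * (2 / B) ≤ N * (2 / B) :=
      mul_le_mul_of_nonneg_right (by rw [hN]; exact_mod_cast hlev) (by positivity)
    have h6 : N * (2 / B) < 1 / 2 := by
      rw [← mul_div_assoc, div_lt_iff₀ hB0]
      linarith
    linarith
  obtain ⟨f, hfE, hf⟩ := chernoff_exists E u (fun i hi => (hu i hi).le) Q rfl hQ0 m hm0 ε hε0 hε1
    F hFE hsum
  obtain ⟨û, hûd⟩ : ∃ û : I → ℝ, ∀ i, û i =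
    Q / m * ((Finset.univ.filter (fun j => f j = i)).card : ℝ) := ⟨_, fun _ => rfl⟩
  have hûnn : ∀ i, 0 ≤ û i := fun i => by rw [hûd]; positivity
  have hû : ∀ D : Finset I, ∑ i ∈ D, û i =
      Q / m * ((Finset.univ.filter (fun j => f j ∈ D)).card : ℝ) := by
    intro D
    rw [Finset.sum_congr rfl (fun i _ => hûd i), ← Finset.mul_sum]
    congr 1
    rw [Finset.card_eq_sum_card_fiberwise (f := f) (t := D)
      (s := Finset.univ.filter (fun j => f j ∈ D)) (fun j hj => by simpa using hj)]
    push_cast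
    refine Finset.sum_congr rfl (fun i hi => ?_)
    congr 2
    ext j
    simp only [Finset.mem_filter, Finset.mem_univ, true_and]
    constructor
    · intro h
      exact ⟨h ▸ hi, h⟩
    · exact fun h => h.2
  have happ : ∀ t, 0 < t → ∀ S, |∑ i ∈ (dl E e S).filter (fun i => t ≤ κ i), û i -
      ∑ i ∈ (dl E e S).filter (fun i => t ≤ κ i), u i| ≤
      ε * ∑ i ∈ (dl E e S).filter (fun i => t ≤ κ i), u i := by
    intro t ht S
    have hcomm : ∀ s, (dl E e S).filter (fun i => s ≤ κ i) = dl (Et s) e S := by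
      intro s
      simp only [dl, Et]
      exact Finset.filter_comm _ _ _
    by_cases hne : (dl (Et t) e S).Nonempty
    · have hEtne : (Et t).Nonempty := hne.mono (Finset.filter_subset _ _)
      obtain ⟨i0, hi0, hmin⟩ := Finset.exists_min_image (Et t) κ hEtne
      have hEq : Et t = Et (κ i0) := by
        ext k
        simp only [Et, Finset.mem_filter]
        constructor
        · rintro ⟨h1, h2⟩
          exact ⟨h1, hmin k (Finset.mem_filter.2 ⟨h1, h2⟩)⟩
        · rintro ⟨h1, h2⟩
          exact ⟨h1, (Finset.mem_filter.1 hi0).2.trans h2⟩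
      rw [hcomm, hû]
      refine hf _ ?_
      refine Finset.mem_biUnion.2 ⟨κ i0, Finset.mem_image_of_mem _ (hEt _ hi0), ?_⟩
      rw [← hEq]
      exact mem_allcuts.2 ⟨Finset.mem_powerset.2 (Finset.filter_subset _ _), ⟨S, rfl⟩, hne⟩
    · rw [hcomm, Finset.not_nonempty_iff_eq_empty.1 hne]
      simp
  refine ⟨Finset.univ.image f, fun i => κ i * û i, ?_, ?_, ?_, ?_⟩
  · intro i hi
    obtain ⟨j, -, rfl⟩ := Finset.mem_image.1 hi
    exact hfE j
  · intro i hi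
    obtain ⟨j, -, rfl⟩ := Finset.mem_image.1 hi
    exact mul_nonneg (hκ _ (hfE j)).le (hûnn _)
  · refine Finset.card_image_le.trans ?_
    simp
  · intro S
    have hS : ∑ i ∈ dl (Finset.univ.image f) e S, κ i * û i = ∑ i ∈ dl E e S, κ i * û i := by
      refine Finset.sum_subset ?_ ?_
      · refine Finset.filter_subset_filter _ ?_
        intro i hi
        obtain ⟨j, -, rfl⟩ := Finset.mem_image.1 hi
        exact hfE j
      · intro i hi hni
        have hz : Finset.univ.filter (fun j => f j = i) = ∅ := by
          refine Finset.filter_eq_empty_iff.2 (fun j _ hj => hni ?_)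
          exact Finset.mem_filter.2 ⟨Finset.mem_image.2 ⟨j, Finset.mem_univ _, hj⟩,
            (Finset.mem_filter.1 hi).2⟩
        simp [hûd, hz]
    have hW : ∑ i ∈ dl E e S, w i = ∑ i ∈ dl E e S, κ i * u i := by
      refine Finset.sum_congr rfl (fun i hi => ?_)
      have := (hκ i (Finset.mem_filter.1 hi).1).ne'
      simp only [u]
      field_simp
    have hpos : ∀ i ∈ dl E e S, 0 < κ i := fun i hi => hκ i (Finset.mem_filter.1 hi).1
    have l1 := layer (fun i => û i - (1 - ε) * u i) _ (dl E e S) κ le_rfl hpos (by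
      intro t ht
      have := (abs_le.1 (happ t ht S)).1
      rw [Finset.sum_sub_distrib, ← Finset.mul_sum]
      linarith)
    have l2 := layer (fun i => (1 + ε) * u i - û i) _ (dl E e S) κ le_rfl hpos (by
      intro t ht
      have := (abs_le.1 (happ t ht S)).2
      rw [Finset.sum_sub_distrib, ← Finset.mul_sum]
      linarith)
    have s1 : ∑ i ∈ dl E e S, κ i * (û i - (1 - ε) * u i) =
        ∑ i ∈ dl E e S, κ i * û i - (1 - ε) * ∑ i ∈ dl E e S, κ i * u i := by
      rw [Finset.mul_sum, ← Finset.sum_sub_distrib]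
      exact Finset.sum_congr rfl (fun i _ => by ring)
    have s2 : ∑ i ∈ dl E e S, κ i * ((1 + ε) * u i - û i) =
        (1 + ε) * ∑ i ∈ dl E e S, κ i * u i - ∑ i ∈ dl E e S, κ i * û i := by
      rw [Finset.mul_sum, ← Finset.sum_sub_distrib]
      exact Finset.sum_congr rfl (fun i _ => by ring)
    rw [hS, hW]
    constructor <;> linarith

lemma size_bound (n k : ℕ) (hn : 1 ≤ n) (hk : 1 ≤ k) (ε : ℝ) (hε0 : 0 < ε) (hε1 : ε < 1) :
    (⌈12 * Real.log (4 ^ (k + 1) * ((2 * n + 1 : ℕ) : ℝ) ^ 4) * ((2 * n + 1 : ℕ) : ℝ) /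
      ε ^ 2⌉₊ : ℝ) ≤ 433 * n * (k + Real.log n) / ε ^ 2 := by
  have hn' : (1 : ℝ) ≤ n := by exact_mod_cast hn
  have hk' : (1 : ℝ) ≤ k := by exact_mod_cast hk
  have hlogn : 0 ≤ Real.log n := Real.log_nonneg hn'
  set N : ℝ := ((2 * n + 1 : ℕ) : ℝ) with hN
  have hNle : N ≤ 3 * n := by rw [hN]; push_cast; linarith
  have hN0 : 1 ≤ N := by rw [hN]; push_cast; linarith
  have hlogN : Real.log N ≤ 2 + Real.log n := by
    have h1 : Real.log N ≤ Real.log (3 * n) := Real.log_le_log (by linarith) hNle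
    rw [Real.log_mul (by norm_num) (by linarith)] at h1
    have h3 := Real.log_le_sub_one_of_pos (by norm_num : (0 : ℝ) < 3)
    linarith
  have hlog4 : Real.log 4 ≤ 2 := by
    have h2 := Real.log_le_sub_one_of_pos (by norm_num : (0 : ℝ) < 2)
    have : (4 : ℝ) = 2 ^ 2 := by norm_num
    rw [this, Real.log_pow]
    push_cast
    linarith
  have hlog : Real.log (4 ^ (k + 1) * N ^ 4) ≤ 12 * (k + Real.log n) := by
    rw [Real.log_mul (by positivity) (by positivity), Real.log_pow, Real.log_pow]
    push_cast
    have : ((k : ℝ) + 1) * Real.log 4 ≤ (k + 1) * 2 :=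
      mul_le_mul_of_nonneg_left hlog4 (by positivity)
    linarith
  have hx0 : 0 ≤ Real.log (4 ^ (k + 1) * N ^ 4) := by
    apply Real.log_nonneg
    have h1 : (1 : ℝ) ≤ 4 ^ (k + 1) := one_le_pow₀ (by norm_num)
    have h2 : 1 ≤ N ^ 4 := one_le_pow₀ hN0
    nlinarith
  refine (Nat.ceil_lt_add_one (by positivity)).le.trans ?_
  have h1 : 12 * Real.log (4 ^ (k + 1) * N ^ 4) * N ≤ 432 * n * (k + Real.log n) := by
    have := mul_le_mul hlog hNle (by linarith) (by positivity)
    linarith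
  rw [le_div_iff₀ (by positivity), add_mul, div_mul_cancel₀ _ (by positivity)]
  have h2 : ε ^ 2 ≤ 1 := pow_le_one₀ hε0.le hε1.le
  have h3 : 1 ≤ n * (k + Real.log n) := by nlinarith
  linarith

/-- There is a constant `C > 0` such that for all integers `n, k ≥ 1`,
every `ε ∈ (0,1)` and every weighted `k`-SAT formula `Φ` over `n` boolean variables
(each clause a disjunction of at most `k` literals, with nonnegative weights), there is
a reweighted sub-formula with at most `C·n·(k + log n)/ε²` clauses whose value on every
truth assignment is within factor `(1 ± ε)` of the value of `Φ`. -/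
theorem stmt16 :
    ∃ C : ℝ, 0 < C ∧
      ∀ (V : Type) [Fintype V] [DecidableEq V], 1 ≤ Fintype.card V →
        ∀ (k : ℕ), 1 ≤ k →
        ∀ (Φ : Finset (Finset (V × Bool))) (w : Finset (V × Bool) → ℝ),
        (∀ c ∈ Φ, c.card ≤ k) →
        (∀ c ∈ Φ, 0 ≤ w c) →
        ∀ ε : ℝ, ε ∈ Set.Ioo (0 : ℝ) 1 →
          ∃ (Φε : Finset (Finset (V × Bool))) (wε : Finset (V × Bool) → ℝ),
            Φε ⊆ Φ ∧ (∀ c ∈ Φε, 0 ≤ wε c) ∧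
            (Φε.card : ℝ) ≤
              C * (Fintype.card V) * (k + Real.log (Fintype.card V)) / ε ^ 2 ∧
            ∀ A : V → Bool,
              (1 - ε) * satVal Φ w A ≤ satVal Φε wε A ∧
                satVal Φε wε A ≤ (1 + ε) * satVal Φ w A := by
  classical
  refine ⟨433, by norm_num, ?_⟩
  intro V _ _ hV k hk Φ w hΦ hw ε hε
  obtain ⟨hε0, hε1⟩ := hε
  have hV' : (1 : ℝ) ≤ Fintype.card V := by exact_mod_cast hV
  have hlogn : 0 ≤ Real.log (Fintype.card V) := Real.log_nonneg hV'
  set E := Φ.filter (fun c => 0 < w c ∧ c.Nonempty) with hEdef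
  have hEΦ : E ⊆ Φ := Finset.filter_subset _ _
  let e : Finset (V × Bool) → Finset (Option (V × Bool)) := fun c => insert none (c.image some)
  let SA : (V → Bool) → Set (Option (V × Bool)) := fun A => {x | ∃ l, x = some l ∧ A l.1 = l.2}
  have hdl : ∀ (G : Finset (Finset (V × Bool))) (A : V → Bool),
      dl G e (SA A) = G.filter (fun c => ∃ l ∈ c, A l.1 = l.2) := by
    intro G A
    exact Finset.filter_congr (fun c _ => hcut_clause c A)
  have hval : ∀ A, satVal Φ w A = ∑ c ∈ dl E e (SA A), w c := by
    intro A
    rw [satVal_eq, hdl]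
    symm
    refine Finset.sum_subset (Finset.filter_subset_filter _ hEΦ) ?_
    intro c hc hnc
    obtain ⟨h1, l, hl, hA⟩ := Finset.mem_filter.1 hc
    by_contra hne
    refine hnc (Finset.mem_filter.2 ⟨Finset.mem_filter.2 ⟨h1, ?_, ⟨l, hl⟩⟩, l, hl, hA⟩)
    exact lt_of_le_of_ne (hw c h1) (Ne.symm hne)
  by_cases hE : E.Nonempty
  · have hcard : Fintype.card (Option (V × Bool)) = 2 * Fintype.card V + 1 := by
      simp [Fintype.card_option, Fintype.card_prod]
      ring
    have hsz := size_bound (Fintype.card V) k hV hk ε hε0 hε1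
    set m := ⌈12 * Real.log (4 ^ (k + 1) * ((2 * Fintype.card V + 1 : ℕ) : ℝ) ^ 4) *
      ((2 * Fintype.card V + 1 : ℕ) : ℝ) / ε ^ 2⌉₊ with hm
    obtain ⟨E', w', h1, h2, h3, h4⟩ := hyper_sparsify (U := Option (V × Bool)) (by omega) E hE w
      (fun c hc => (Finset.mem_filter.1 hc).2.1) (k + 1) e
      (fun c hc => (Finset.card_insert_le _ _).trans
        (Nat.succ_le_succ (Finset.card_image_le.trans (hΦ c (hEΦ hc)))))
      (fun c hc => by
        obtain ⟨l, hl⟩ := (Finset.mem_filter.1 hc).2.2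
        exact ⟨SA (fun _ => l.2), (hcut_clause c (fun _ => l.2)).2 ⟨l, hl, rfl⟩⟩)
      ε hε0 hε1 m (by rw [hcard]; exact Nat.le_ceil _)
    refine ⟨E', w', h1.trans hEΦ, h2, ?_, ?_⟩
    · refine le_trans ?_ hsz
      exact_mod_cast h3
    · intro A
      have := h4 (SA A)
      rw [← hval, hdl E', ← satVal_eq] at this
      exact this
  · refine ⟨∅, w, by simp, by simp, ?_, ?_⟩
    · simp only [Finset.card_empty, Nat.cast_zero]
      positivity
    · intro A
      have h0 : satVal Φ w A = 0 := by
        rw [hval, Finset.not_nonempty_iff_eq_empty.1 hE]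
        simp [dl]
      have h1 : satVal ∅ w A = 0 := by simp [satVal]
      rw [h0, h1]
      simp
end

section
/- There is a constant C > 0 such that for every undirected weighted graph G on n vertices and every ε ∈ (0,1), there exists a reweighted subgraph G_ε of G with at most C·n/ε² edges such that for every x ∈ ℝⁿ, (1−ε)·xᵀ U_G x ≤ xᵀ U_{G_ε} x ≤ (1+ε)·xᵀ U_G x, where U_H = D_H + A_H denotes the negated Laplacian of a graph H. In particular, G_ε is an ε-unCut-sparsifier of G. -/
open Finset

/-- The quadratic form `xᵀ U_H x` of the negated Laplacian `U_H = D_H + A_H` of the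
graph with adjacency (weight) matrix `A`, where `D_H` is the diagonal matrix of weighted
degrees. -/
noncomputable def negLapQuad {n : ℕ} (A : Fin n → Fin n → ℝ) (x : Fin n → ℝ) : ℝ :=
  ∑ i, ∑ j, ((if i = j then ∑ l, A i l else 0) + A i j) * x i * x j

/-- `unCut_G(S)`: the total weight of edges whose two endpoints are both in `S` or both
in the complement of `S` (summing over unordered pairs `i < j`). -/
noncomputable def unCutVal {n : ℕ} (A : Fin n → Fin n → ℝ) (S : Finset (Fin n)) : ℝ :=
  ∑ i, ∑ j ∈ Finset.univ.filter (fun j => i < j),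
    if (i ∈ S) ↔ (j ∈ S) then A i j else 0


theorem bss_spectral {ι : Type} [Fintype ι] [DecidableEq ι] (P : Matrix ι ι ℝ)
    (hP : P.IsHermitian) :
    ∃ (Q : Matrix ι ι ℝ), Q * Q.transpose = 1 ∧ Q.transpose * Q = 1 ∧
      P = Q * Matrix.diagonal hP.eigenvalues * Q.transpose := by
  refine ⟨(hP.eigenvectorUnitary : Matrix ι ι ℝ), ?_, ?_, ?_⟩
  · have := (Matrix.mem_unitaryGroup_iff).1 hP.eigenvectorUnitary.2
    simpa [Matrix.star_eq_conjTranspose] using this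
  · have := (Matrix.mem_unitaryGroup_iff').1 hP.eigenvectorUnitary.2
    simpa [Matrix.star_eq_conjTranspose] using this
  · have := hP.spectral_theorem
    rw [Unitary.conjStarAlgAut_apply] at this
    simpa [Matrix.star_eq_conjTranspose, Function.comp_def] using this

theorem bss_shift {ι : Type} [Fintype ι] [DecidableEq ι] (P : Matrix ι ι ℝ)
    (hP : P.IsHermitian) (c : ℝ) (hc : ∀ i, 0 < hP.eigenvalues i + c) :
    (P + c • (1 : Matrix ι ι ℝ)).PosDef ∧
    (P + c • (1 : Matrix ι ι ℝ))⁻¹.trace = ∑ i, 1 / (hP.eigenvalues i + c) ∧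
    ((P + c • (1 : Matrix ι ι ℝ))⁻¹ * (P + c • (1 : Matrix ι ι ℝ))⁻¹).trace
      = ∑ i, (1 / (hP.eigenvalues i + c)) ^ 2 := by
  obtain ⟨Q, h1, h2, h3⟩ := bss_spectral P hP
  set μ := hP.eigenvalues
  have e : P + c • (1 : Matrix ι ι ℝ) = Q * Matrix.diagonal (fun i => μ i + c) * Q.transpose := by
    have : Matrix.diagonal (fun i => μ i + c) = Matrix.diagonal μ + c • (1 : Matrix ι ι ℝ) := by
      rw [Matrix.smul_one_eq_diagonal, Matrix.diagonal_add]
    rw [this, mul_add, add_mul, ← h3]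
    simp [h1]
  have key : ∀ f g : ι → ℝ, (Q * Matrix.diagonal f * Q.transpose) *
      (Q * Matrix.diagonal g * Q.transpose) =
      Q * Matrix.diagonal (fun i => f i * g i) * Q.transpose := by
    intro f g
    calc _ = Q * Matrix.diagonal f * (Q.transpose * Q) * Matrix.diagonal g * Q.transpose := by
          simp only [mul_assoc]
      _ = _ := by rw [h2, mul_one, mul_assoc Q, Matrix.diagonal_mul_diagonal]
  have tr : ∀ f : ι → ℝ, (Q * Matrix.diagonal f * Q.transpose).trace = ∑ i, f i := by
    intro f
    rw [Matrix.trace_mul_comm, ← mul_assoc, h2, one_mul, Matrix.trace_diagonal]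
  have inv : (P + c • (1 : Matrix ι ι ℝ))⁻¹ =
      Q * Matrix.diagonal (fun i => 1 / (μ i + c)) * Q.transpose := by
    apply Matrix.inv_eq_right_inv
    rw [e, key]
    have : (fun i => (μ i + c) * (1 / (μ i + c))) = fun _ => 1 := by
      ext i; have := (hc i).ne'; field_simp
    rw [this, Matrix.diagonal_one, mul_one, h1]
  refine ⟨?_, ?_, ?_⟩
  · rw [e]
    have := (Matrix.PosDef.diagonal hc).conjTranspose_mul_mul_same (B := Q.transpose) (by
      intro x y hxy
      have := congrArg (fun z => Matrix.mulVec Q z) hxy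
      simpa [Matrix.mulVec_mulVec, h1] using this)
    simpa using this
  · rw [inv, tr]
  · rw [inv, key, tr]; simp only [sq]

theorem bss_rank_one {ι : Type} [Fintype ι] [DecidableEq ι] (P : Matrix ι ι ℝ)
    (hP : P.PosDef) (v : ι → ℝ) (t : ℝ)
    (ht : 0 < 1 + t * (v ⬝ᵥ (P⁻¹.mulVec v))) :
    (P + t • Matrix.vecMulVec v v).PosDef ∧
    (P + t • Matrix.vecMulVec v v)⁻¹.trace =
      P⁻¹.trace - t * (v ⬝ᵥ ((P⁻¹ * P⁻¹).mulVec v)) / (1 + t * (v ⬝ᵥ (P⁻¹.mulVec v))) := by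
  have hPu : IsUnit P.det := (Matrix.isUnit_iff_isUnit_det _).1 hP.isUnit
  have hPi : P * P⁻¹ = 1 := Matrix.mul_nonsing_inv _ hPu
  have hB := hP.inv
  set B := P⁻¹ with hBdef
  have hBt : B.transpose = B := by simpa using hB.1.eq
  have hPt : P.transpose = P := by simpa using hP.1.eq
  set p := v ⬝ᵥ (B.mulVec v) with hp
  have vB : Matrix.vecMul v B = B.mulVec v := by
    rw [← Matrix.mulVec_transpose, hBt]
  constructor
  · apply Matrix.PosDef.of_dotProduct_mulVec_pos
    · refine hP.1.add ?_
      ext i j; simp [Matrix.vecMulVec_apply]; left; ring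
    · intro x hx
      have h0 := hP.dotProduct_mulVec_pos hx
      simp only [star_trivial] at h0 ⊢
      have e : x ⬝ᵥ ((P + t • Matrix.vecMulVec v v).mulVec x) =
          x ⬝ᵥ (P.mulVec x) + t * (v ⬝ᵥ x) ^ 2 := by
        rw [Matrix.add_mulVec, dotProduct_add, Matrix.smul_mulVec, Matrix.vecMulVec_mulVec,
          dotProduct_smul]
        simp [dotProduct_comm x v]; ring_nf; simp
      rw [e]
      rcases le_or_gt 0 t with h | h
      · nlinarith [mul_nonneg h (sq_nonneg (v ⬝ᵥ x))]
      · have cs : (v ⬝ᵥ x) ^ 2 ≤ p * (x ⬝ᵥ (P.mulVec x)) := by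
          have q : ∀ s : ℝ, 0 ≤ x ⬝ᵥ (P.mulVec x) - 2 * s * (v ⬝ᵥ x) + s ^ 2 * p := by
            intro s
            have := hP.posSemidef.dotProduct_mulVec_nonneg (x - s • B.mulVec v)
            simp only [star_trivial] at this
            have e1 : P.mulVec (B.mulVec v) = v := by rw [Matrix.mulVec_mulVec, hPi, Matrix.one_mulVec]
            have e2 : (B.mulVec v) ⬝ᵥ (P.mulVec x) = v ⬝ᵥ x := by
              rw [Matrix.dotProduct_mulVec, ← Matrix.mulVec_transpose, hPt, e1]
            rw [Matrix.mulVec_sub, Matrix.mulVec_smul, e1] at this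
            simp only [sub_dotProduct, dotProduct_sub, smul_dotProduct, dotProduct_smul, e2,
              smul_eq_mul] at this
            rw [dotProduct_comm x v, dotProduct_comm (B.mulVec v) v, ← hp] at this
            linarith
          have := q ((x ⬝ᵥ (P.mulVec x)) / (v ⬝ᵥ x))
          by_cases hvx : v ⬝ᵥ x = 0
          · have hp0 : 0 ≤ p := by
              have := hB.posSemidef.dotProduct_mulVec_nonneg v
              simpa using this
            rw [hvx]; simp; positivity
          · have e3 : x ⬝ᵥ (P.mulVec x) - 2 * ((x ⬝ᵥ (P.mulVec x)) / (v ⬝ᵥ x)) * (v ⬝ᵥ x)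
              + ((x ⬝ᵥ (P.mulVec x)) / (v ⬝ᵥ x)) ^ 2 * p =
              (x ⬝ᵥ (P.mulVec x)) / (v ⬝ᵥ x) ^ 2 * (p * (x ⬝ᵥ (P.mulVec x)) - (v ⬝ᵥ x) ^ 2) := by
              field_simp; ring
            rw [e3] at this
            have h4 : 0 < (x ⬝ᵥ (P.mulVec x)) / (v ⬝ᵥ x) ^ 2 := by positivity
            have := nonneg_of_mul_nonneg_right this h4
            linarith
        nlinarith [mul_pos ht h0]
  · have inv : (P + t • Matrix.vecMulVec v v)⁻¹ =
        B - (t / (1 + t * p)) • Matrix.vecMulVec (B.mulVec v) (B.mulVec v) := by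
      apply Matrix.inv_eq_right_inv
      rw [add_mul, mul_sub, mul_sub, hPi, Matrix.mul_smul, Matrix.mul_vecMulVec,
        Matrix.mulVec_mulVec, hPi, Matrix.one_mulVec, Matrix.smul_mul, Matrix.vecMulVec_mul, vB,
        Matrix.smul_mul, Matrix.mul_smul, Matrix.vecMulVec_mul_vecMulVec, ← hp]
      ext i j
      simp [Matrix.vecMulVec_apply]
      field_simp
      ring
    rw [inv, Matrix.trace_sub, Matrix.trace_smul, Matrix.trace_vecMulVec,
      ← Matrix.mulVec_mulVec, Matrix.dotProduct_mulVec v, vB, smul_eq_mul]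
    ring

theorem bss_upper_avg {ι : Type} [Fintype ι] [DecidableEq ι] [Nonempty ι] (P : Matrix ι ι ℝ)
    (hP : P.PosDef) (δ : ℝ) (hδ : 0 < δ) :
    (P + δ • (1 : Matrix ι ι ℝ)).PosDef ∧
    0 < P⁻¹.trace - (P + δ • (1 : Matrix ι ι ℝ))⁻¹.trace ∧
    ((P + δ • (1 : Matrix ι ι ℝ))⁻¹ * (P + δ • (1 : Matrix ι ι ℝ))⁻¹).trace /
      (P⁻¹.trace - (P + δ • (1 : Matrix ι ι ℝ))⁻¹.trace) + (P + δ • (1 : Matrix ι ι ℝ))⁻¹.trace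
      < 1 / δ + P⁻¹.trace := by
  have hpos := fun i => hP.eigenvalues_pos i
  have h0 := (bss_shift P hP.1 0 (by simpa using hpos)).2.1
  simp only [zero_smul, add_zero] at h0
  obtain ⟨h1, h2, h3⟩ := bss_shift P hP.1 δ (fun i => by have := hpos i; linarith)
  refine ⟨h1, ?_⟩
  rw [h0, h2, h3]
  set μ := hP.1.eigenvalues
  have hd : ∑ i, 1 / μ i - ∑ i, 1 / (μ i + δ) = δ * ∑ i, (1 / μ i) * (1 / (μ i + δ)) := by
    rw [← Finset.sum_sub_distrib, Finset.mul_sum]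
    refine Finset.sum_congr rfl fun i _ => ?_
    have := hpos i
    have : 0 < μ i := this
    field_simp; ring
  have hS : 0 < ∑ i, (1 / μ i) * (1 / (μ i + δ)) := by
    apply Finset.sum_pos _ Finset.univ_nonempty
    intro i _
    have : 0 < μ i := hpos i
    positivity
  have hle : ∑ i, (1 / (μ i + δ)) ^ 2 ≤ ∑ i, (1 / μ i) * (1 / (μ i + δ)) := by
    apply Finset.sum_le_sum
    intro i _
    have : 0 < μ i := hpos i
    rw [sq]
    gcongr
    linarith
  have hp : 0 < ∑ i, 1 / μ i - ∑ i, 1 / (μ i + δ) := by rw [hd]; positivity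
  refine ⟨hp, ?_⟩
  have : (∑ i, (1 / (μ i + δ)) ^ 2) / (∑ i, 1 / μ i - ∑ i, 1 / (μ i + δ)) ≤ 1 / δ := by
    rw [div_le_div_iff₀ hp hδ, hd]; nlinarith
  linarith

theorem bss_lower_avg {ι : Type} [Fintype ι] [DecidableEq ι] [Nonempty ι] (P : Matrix ι ι ℝ)
    (hP : P.PosDef) (hb : P⁻¹.trace < 1) :
    (P + (-1 : ℝ) • (1 : Matrix ι ι ℝ)).PosDef ∧
    0 < (P + (-1 : ℝ) • (1 : Matrix ι ι ℝ))⁻¹.trace - P⁻¹.trace ∧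
    1 - P⁻¹.trace ≤
    ((P + (-1 : ℝ) • (1 : Matrix ι ι ℝ))⁻¹ * (P + (-1 : ℝ) • (1 : Matrix ι ι ℝ))⁻¹).trace /
      ((P + (-1 : ℝ) • (1 : Matrix ι ι ℝ))⁻¹.trace - P⁻¹.trace)
      - (P + (-1 : ℝ) • (1 : Matrix ι ι ℝ))⁻¹.trace := by
  have hpos := fun i => hP.eigenvalues_pos i
  have h0 := (bss_shift P hP.1 0 (by simpa using hpos)).2.1
  simp only [zero_smul, add_zero] at h0
  have hgt : ∀ i, 0 < hP.1.eigenvalues i + (-1) := by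
    intro i
    have h : 1 / hP.1.eigenvalues i ≤ ∑ i, 1 / hP.1.eigenvalues i :=
      Finset.single_le_sum (f := fun i => 1 / hP.1.eigenvalues i)
        (fun j _ => by have := hpos j; positivity) (Finset.mem_univ i)
    have h' : 1 / hP.1.eigenvalues i < 1 := by linarith
    rw [div_lt_one (hpos i)] at h'
    linarith
  obtain ⟨h1, h2, h3⟩ := bss_shift P hP.1 (-1) hgt
  refine ⟨h1, ?_⟩
  rw [h0] at hb
  rw [h0, h2, h3]
  set μ := hP.1.eigenvalues
  have hd : ∑ i, 1 / (μ i + -1) - ∑ i, 1 / μ i = ∑ i, (1 / μ i) * (1 / (μ i + -1)) := by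
    rw [← Finset.sum_sub_distrib]
    refine Finset.sum_congr rfl fun i _ => ?_
    have h1 : μ i ≠ 0 := (hpos i).ne'
    have h2 := (hgt i).ne'
    field_simp; ring
  have hS : 0 < ∑ i, (1 / μ i) * (1 / (μ i + -1)) := by
    apply Finset.sum_pos _ Finset.univ_nonempty
    intro i _
    have h1 : 0 < μ i := hpos i
    have h2 := hgt i
    positivity
  have hcs : (∑ i, (1 / μ i) * (1 / (μ i + -1))) ^ 2 ≤
      (∑ i, 1 / μ i) * ∑ i, (1 / μ i) * (1 / (μ i + -1)) ^ 2 := by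
    apply Finset.sum_sq_le_sum_mul_sum_of_sq_le_mul
    · intro i _; have h1 : 0 < μ i := hpos i
      positivity
    · intro i _; have h1 : 0 < μ i := hpos i
      positivity
    · intro i _; apply le_of_eq; ring
  have hq : ∑ i, (1 / (μ i + -1)) ^ 2 - ∑ i, (1 / μ i) * (1 / (μ i + -1)) =
      ∑ i, (1 / μ i) * (1 / (μ i + -1)) ^ 2 := by
    rw [← Finset.sum_sub_distrib]
    refine Finset.sum_congr rfl fun i _ => ?_
    have h1 : μ i ≠ 0 := (hpos i).ne'
    have h2 := (hgt i).ne'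
    field_simp; ring
  have hn : 0 ≤ ∑ i, (1 / μ i) * (1 / (μ i + -1)) ^ 2 := by
    apply Finset.sum_nonneg
    intro i _; have h1 : 0 < μ i := hpos i
    positivity
  refine ⟨by rw [hd]; exact hS, ?_⟩
  have : 1 + (∑ i, 1 / (μ i + -1) - ∑ i, 1 / μ i) ≤
      (∑ i, (1 / (μ i + -1)) ^ 2) / (∑ i, 1 / (μ i + -1) - ∑ i, 1 / μ i) := by
    rw [hd, le_div_iff₀ hS]
    nlinarith
  linarith

theorem bss_step {ι E : Type} [Fintype ι] [DecidableEq ι] [Nonempty ι] [Fintype E]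
    (v : E → ι → ℝ) (hv : ∑ e, Matrix.vecMulVec (v e) (v e) = 1)
    (A : Matrix ι ι ℝ) (u l δ a b : ℝ) (hδ : 0 < δ) (hb1 : b < 1) (hab : 1 / δ + a ≤ 1 - b)
    (hU : (u • (1 : Matrix ι ι ℝ) - A).PosDef) (hL : (A - l • (1 : Matrix ι ι ℝ)).PosDef)
    (ha : (u • (1 : Matrix ι ι ℝ) - A)⁻¹.trace ≤ a)
    (hb : (A - l • (1 : Matrix ι ι ℝ))⁻¹.trace ≤ b) :
    ∃ (e : E) (t : ℝ), 0 ≤ t ∧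
      ((u + δ) • (1 : Matrix ι ι ℝ) - (A + t • Matrix.vecMulVec (v e) (v e))).PosDef ∧
      ((A + t • Matrix.vecMulVec (v e) (v e)) - (l + 1) • (1 : Matrix ι ι ℝ)).PosDef ∧
      ((u + δ) • (1 : Matrix ι ι ℝ) - (A + t • Matrix.vecMulVec (v e) (v e)))⁻¹.trace ≤ a ∧
      ((A + t • Matrix.vecMulVec (v e) (v e)) - (l + 1) • (1 : Matrix ι ι ℝ))⁻¹.trace ≤ b := by
  have trsum : ∀ M : Matrix ι ι ℝ, ∑ e, (v e) ⬝ᵥ (M.mulVec (v e)) = M.trace := by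
    intro M
    calc _ = ∑ e, (M * Matrix.vecMulVec (v e) (v e)).trace := by
          refine Finset.sum_congr rfl fun e _ => ?_
          rw [Matrix.mul_vecMulVec, Matrix.trace_vecMulVec, dotProduct_comm]
      _ = (M * ∑ e, Matrix.vecMulVec (v e) (v e)).trace := by
          rw [Finset.mul_sum, Matrix.trace_sum]
      _ = _ := by rw [hv, mul_one]
  obtain ⟨p1, p2, p3⟩ := bss_upper_avg _ hU δ hδ
  obtain ⟨r1, r2, r3⟩ := bss_lower_avg _ hL (by linarith)
  set P := u • (1 : Matrix ι ι ℝ) - A with hPd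
  set R := A - l • (1 : Matrix ι ι ℝ) with hRd
  set P' := P + δ • (1 : Matrix ι ι ℝ) with hP'
  set R' := R + (-1 : ℝ) • (1 : Matrix ι ι ℝ) with hR'
  set Δ := P⁻¹.trace - P'⁻¹.trace with hΔ
  set Γ := R'⁻¹.trace - R⁻¹.trace with hΓ
  have hlt : ∑ e, ((v e) ⬝ᵥ ((P'⁻¹ * P'⁻¹).mulVec (v e)) / Δ + (v e) ⬝ᵥ (P'⁻¹.mulVec (v e))) <
      ∑ e, ((v e) ⬝ᵥ ((R'⁻¹ * R'⁻¹).mulVec (v e)) / Γ - (v e) ⬝ᵥ (R'⁻¹.mulVec (v e))) := by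
    rw [Finset.sum_add_distrib, Finset.sum_sub_distrib, ← Finset.sum_div, ← Finset.sum_div,
      trsum, trsum, trsum, trsum]
    linarith
  obtain ⟨e, -, he⟩ := Finset.exists_lt_of_sum_lt hlt
  have psd : ∀ M : Matrix ι ι ℝ, M.PosDef → 0 ≤ (v e) ⬝ᵥ (M⁻¹.mulVec (v e)) ∧
      0 ≤ (v e) ⬝ᵥ ((M⁻¹ * M⁻¹).mulVec (v e)) := by
    intro M hM
    constructor
    · simpa using hM.inv.posSemidef.dotProduct_mulVec_nonneg (v e)
    · have h : (M⁻¹ * M⁻¹).PosSemidef := by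
        have := Matrix.posSemidef_conjTranspose_mul_self M⁻¹
        rwa [hM.inv.1.eq] at this
      simpa using h.dotProduct_mulVec_nonneg (v e)
  obtain ⟨a1, a2⟩ := psd _ p1
  obtain ⟨b1, b2⟩ := psd _ r1
  have tU := bss_rank_one P' p1 (v e)
  have tL := bss_rank_one R' r1 (v e)
  set pU := (v e) ⬝ᵥ (P'⁻¹.mulVec (v e))
  set qU := (v e) ⬝ᵥ ((P'⁻¹ * P'⁻¹).mulVec (v e))
  set pL := (v e) ⬝ᵥ (R'⁻¹.mulVec (v e))
  set qL := (v e) ⬝ᵥ ((R'⁻¹ * R'⁻¹).mulVec (v e))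
  obtain ⟨c, hc⟩ : ∃ c, c = qL / Γ - pL := ⟨_, rfl⟩
  rw [← hc] at he
  have hq0 : 0 ≤ qU / Δ := by positivity
  have hcp : 0 < c - pU := by linarith
  have hc0 : 0 < c := by linarith
  have eU : (u + δ) • (1 : Matrix ι ι ℝ) - (A + (1 / c) • Matrix.vecMulVec (v e) (v e)) =
      P' + (-(1 / c)) • Matrix.vecMulVec (v e) (v e) := by
    rw [hP', hPd, add_smul, neg_smul]; abel
  have eL : (A + (1 / c) • Matrix.vecMulVec (v e) (v e)) - (l + 1) • (1 : Matrix ι ι ℝ) =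
      R' + (1 / c) • Matrix.vecMulVec (v e) (v e) := by
    rw [hR', hRd, add_smul, neg_smul]; abel
  have f1 : 1 + -(1 / c) * pU = (c - pU) / c := by field_simp; ring
  have f2 : 1 + (1 / c) * pL = (c + pL) / c := by field_simp
  obtain ⟨u1, u2⟩ := tU (-(1 / c)) (by rw [f1]; positivity)
  obtain ⟨l1, l2⟩ := tL (1 / c) (by rw [f2]; positivity)
  refine ⟨e, 1 / c, by positivity, ?_, ?_, ?_, ?_⟩
  · rw [eU]; exact u1
  · rw [eL]; exact l1
  · rw [eU, u2, f1]
    have : -(1 / c) * qU / ((c - pU) / c) = - (qU / (c - pU)) := by field_simp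
    rw [this]
    have : qU / (c - pU) ≤ Δ := by
      rw [div_le_iff₀ hcp, ← div_le_iff₀' p2]; linarith
    linarith
  · rw [eL, l2, f2]
    have : (1 / c) * qL / ((c + pL) / c) = qL / (c + pL) := by field_simp
    rw [this, hc]
    have h1 : qL / Γ - pL + pL = qL / Γ := by ring
    have hq : 0 < qL := by
      have : 0 < qL / Γ := by linarith
      by_contra h
      have : qL / Γ ≤ 0 := div_nonpos_of_nonpos_of_nonneg (not_lt.1 h) r2.le
      linarith
    rw [h1, div_div_cancel₀ hq.ne']
    linarith

theorem bss_iter {ι E : Type} [Fintype ι] [DecidableEq ι] [Nonempty ι] [Fintype E] [DecidableEq E]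
    (v : E → ι → ℝ) (hv : ∑ e, Matrix.vecMulVec (v e) (v e) = 1)
    (u l δ a b : ℝ) (hδ : 0 < δ) (hb1 : b < 1) (hab : 1 / δ + a ≤ 1 - b)
    (hu : 0 < u) (hl : l < 0) (ha : Fintype.card ι / u ≤ a) (hb : Fintype.card ι / (-l) ≤ b)
    (k : ℕ) :
    ∃ s : E → ℝ, (∀ e, 0 ≤ s e) ∧ (Finset.univ.filter fun e => s e ≠ 0).card ≤ k ∧
      ((u + k * δ) • (1 : Matrix ι ι ℝ) - ∑ e, s e • Matrix.vecMulVec (v e) (v e)).PosDef ∧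
      ((∑ e, s e • Matrix.vecMulVec (v e) (v e)) - (l + k) • (1 : Matrix ι ι ℝ)).PosDef ∧
      ((u + k * δ) • (1 : Matrix ι ι ℝ) - ∑ e, s e • Matrix.vecMulVec (v e) (v e))⁻¹.trace ≤ a ∧
      ((∑ e, s e • Matrix.vecMulVec (v e) (v e)) - (l + k) • (1 : Matrix ι ι ℝ))⁻¹.trace ≤ b := by
  induction k with
  | zero =>
    have pd : ∀ c : ℝ, 0 < c → (c • (1 : Matrix ι ι ℝ)).PosDef ∧
        (c • (1 : Matrix ι ι ℝ))⁻¹.trace = Fintype.card ι / c := by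
      intro c hc
      refine ⟨Matrix.PosDef.one.smul hc, ?_⟩
      have : (c • (1 : Matrix ι ι ℝ))⁻¹ = c⁻¹ • (1 : Matrix ι ι ℝ) := by
        apply Matrix.inv_eq_right_inv
        simp [smul_smul, hc.ne']
      rw [this, Matrix.trace_smul, Matrix.trace_one, smul_eq_mul]; ring
    obtain ⟨h1, h2⟩ := pd u hu
    obtain ⟨h3, h4⟩ := pd (-l) (by linarith)
    refine ⟨fun _ => 0, fun _ => le_rfl, by simp, ?_, ?_, ?_, ?_⟩
    · simpa using h1
    · simpa using h3
    · simpa [h2] using ha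
    · have e : (∑ e, (0 : ℝ) • Matrix.vecMulVec (v e) (v e)) - (l + (0 : ℕ)) • (1 : Matrix ι ι ℝ) =
          (-l) • (1 : Matrix ι ι ℝ) := by simp
      rw [e, h4]; exact hb
  | succ k ih =>
    obtain ⟨s, s0, sc, h1, h2, h3, h4⟩ := ih
    obtain ⟨e, t, t0, g1, g2, g3, g4⟩ := bss_step v hv _ _ _ δ a b hδ hb1 hab h1 h2 h3 h4
    have es : ∑ e', (s e' + if e' = e then t else 0) • Matrix.vecMulVec (v e') (v e') =
        (∑ e, s e • Matrix.vecMulVec (v e) (v e)) + t • Matrix.vecMulVec (v e) (v e) := by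
      simp [add_smul, Finset.sum_add_distrib, ite_smul]
    have eu : u + ((k + 1 : ℕ) : ℝ) * δ = u + k * δ + δ := by push_cast; ring
    have el : l + ((k + 1 : ℕ) : ℝ) = l + k + 1 := by push_cast; ring
    refine ⟨fun e' => s e' + if e' = e then t else 0, ?_, ?_, ?_, ?_, ?_, ?_⟩
    · intro e'
      have := s0 e'
      dsimp only
      split_ifs <;> linarith
    · have : (Finset.univ.filter fun e' => s e' + (if e' = e then t else 0) ≠ 0) ⊆
          insert e (Finset.univ.filter fun e => s e ≠ 0) := by
        intro e' he'
        by_cases h : e' = e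
        · simp [h]
        · simpa [h] using he'
      exact (Finset.card_le_card this).trans ((Finset.card_insert_le _ _).trans (by omega))
    · rw [es, eu]; exact g1
    · rw [es, el]; exact g2
    · rw [es, eu]; exact g3
    · rw [es, el]; exact g4

theorem bss_quad {ι E : Type} [Fintype ι] [DecidableEq ι] [Fintype E]
    (v : E → ι → ℝ) (s : E → ℝ) (y : ι → ℝ) :
    y ⬝ᵥ ((∑ e, s e • Matrix.vecMulVec (v e) (v e)).mulVec y) = ∑ e, s e * (v e ⬝ᵥ y) ^ 2 := by
  rw [Matrix.sum_mulVec, dotProduct_sum]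
  refine Finset.sum_congr rfl fun e _ => ?_
  rw [Matrix.smul_mulVec, Matrix.vecMulVec_mulVec, dotProduct_smul, dotProduct_comm y]
  simp
  left; ring

theorem bss_main {ι E : Type} [Fintype ι] [DecidableEq ι] [Fintype E] [DecidableEq E]
    (v : E → ι → ℝ) (hv : ∑ e, Matrix.vecMulVec (v e) (v e) = 1)
    (ε : ℝ) (h0 : 0 < ε) (h1 : ε < 1) :
    ∃ s : E → ℝ, (∀ e, 0 ≤ s e) ∧
      ((Finset.univ.filter fun e => s e ≠ 0).card : ℝ) ≤ 5 * Fintype.card ι / ε ^ 2 ∧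
      ∀ y : ι → ℝ, (1 - ε) * (y ⬝ᵥ y) ≤ ∑ e, s e * (v e ⬝ᵥ y) ^ 2 ∧
        ∑ e, s e * (v e ⬝ᵥ y) ^ 2 ≤ (1 + ε) * (y ⬝ᵥ y) := by
  rcases isEmpty_or_nonempty ι with hι | hι
  · exact ⟨fun _ => 0, fun _ => le_rfl, by simp, fun y => by simp⟩
  have hd : (1 : ℝ) ≤ Fintype.card ι := by exact_mod_cast Fintype.card_pos
  obtain ⟨d, hdd⟩ : ∃ d : ℝ, d = Fintype.card ι := ⟨_, rfl⟩
  rw [← hdd] at hd ⊢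
  have h2 : 0 < 2 - ε := by linarith
  have hd0 : 0 < d := by linarith
  set T := ⌈d * (4 / ε ^ 2)⌉₊
  have hT1 : d * (4 / ε ^ 2) ≤ T := Nat.le_ceil _
  have hT2 : (T : ℝ) ≤ d * (4 / ε ^ 2) + 1 := (Nat.ceil_lt_add_one (by positivity)).le
  obtain ⟨s, s0, sc, k1, k2, -, -⟩ := bss_iter v hv (d * (2 / ε) * ((2 + ε) / (2 - ε)))
    (-(d * (2 / ε))) ((2 + ε) / (2 - ε)) (ε * (2 - ε) / (2 * (2 + ε))) (ε / 2)
    (by positivity) (by linarith)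
    (by apply le_of_eq; field_simp) (by positivity)
    (by have : 0 < d * (2 / ε) := by positivity
        linarith)
    (by rw [← hdd]; apply le_of_eq; field_simp)
    (by rw [← hdd]; apply le_of_eq; field_simp) T
  set l := -(d * (2 / ε)) + (T : ℝ) with hl
  set u := d * (2 / ε) * ((2 + ε) / (2 - ε)) + T * ((2 + ε) / (2 - ε)) with hu
  have hm : d * (2 / ε) * 2 ≤ T * ε := by
    have := mul_le_mul_of_nonneg_right hT1 h0.le
    calc d * (2 / ε) * 2 = d * (4 / ε ^ 2) * ε := by field_simp; ring
      _ ≤ _ := this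
  have hdε : 0 < d * (2 / ε) := by positivity
  have hTp : 0 < (T : ℝ) := lt_of_lt_of_le (by positivity) hT1
  have hlp : 0 < l := by rw [hl]; nlinarith
  have hul : (1 - ε) * u ≤ (1 + ε) * l := by
    have e1 : u = ((2 + ε) / (2 - ε)) * (T + d * (2 / ε)) := by rw [hu]; ring
    have e2 : T + d * (2 / ε) ≤ ((2 + ε) / (2 - ε)) * l := by
      rw [div_mul_eq_mul_div, le_div_iff₀ h2, hl]; nlinarith
    have e3 : (1 - ε) * ((2 + ε) / (2 - ε)) ^ 2 ≤ 1 + ε := by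
      rw [div_pow, mul_div_assoc', div_le_iff₀ (by positivity)]
      nlinarith [pow_pos h0 3]
    calc (1 - ε) * u ≤ (1 - ε) * (((2 + ε) / (2 - ε)) * (((2 + ε) / (2 - ε)) * l)) := by
          rw [e1]
          have : 0 ≤ 1 - ε := by linarith
          gcongr
      _ = (1 - ε) * ((2 + ε) / (2 - ε)) ^ 2 * l := by ring
      _ ≤ _ := by gcongr
  refine ⟨fun e => (1 - ε) / l * s e, ?_, ?_, ?_⟩
  · intro e
    have := s0 e
    have : 0 ≤ 1 - ε := by linarith
    positivity
  · have : (Finset.univ.filter fun e => (1 - ε) / l * s e ≠ 0) ⊆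
        (Finset.univ.filter fun e => s e ≠ 0) := by
      intro e he
      simp only [Finset.mem_filter, Finset.mem_univ, true_and] at he ⊢
      exact right_ne_zero_of_mul he
    have h5 : ((Finset.univ.filter fun e => (1 - ε) / l * s e ≠ 0).card : ℝ) ≤ T := by
      exact_mod_cast (Finset.card_le_card this).trans sc
    refine h5.trans (hT2.trans ?_)
    rw [le_div_iff₀ (by positivity)]
    have : d * (4 / ε ^ 2) * ε ^ 2 = 4 * d := by field_simp
    nlinarith
  · intro y
    have q1 := k1.posSemidef.dotProduct_mulVec_nonneg y
    have q2 := k2.posSemidef.dotProduct_mulVec_nonneg y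
    simp only [star_trivial, Matrix.sub_mulVec, dotProduct_sub, bss_quad, Matrix.smul_mulVec,
      Matrix.one_mulVec, dotProduct_smul, smul_eq_mul] at q1 q2
    have e : ∑ e, (1 - ε) / l * s e * (v e ⬝ᵥ y) ^ 2 =
        (1 - ε) * (∑ e, s e * (v e ⬝ᵥ y) ^ 2) / l := by
      rw [Finset.mul_sum, Finset.sum_div]
      refine Finset.sum_congr rfl fun e _ => ?_
      ring
    have hy : 0 ≤ y ⬝ᵥ y := by
      simpa using dotProduct_star_self_nonneg y
    have h1' : 0 ≤ 1 - ε := by linarith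
    rw [e]
    constructor
    · rw [le_div_iff₀ hlp]
      nlinarith [mul_nonneg h1' q2]
    · rw [div_le_iff₀ hlp]
      nlinarith [mul_nonneg h1' q1, mul_le_mul_of_nonneg_right hul hy]

theorem bss_general {E : Type} [Fintype E] [DecidableEq E] (n : ℕ) (b : E → Fin n → ℝ)
    (ε : ℝ) (h0 : 0 < ε) (h1 : ε < 1) :
    ∃ s : E → ℝ, (∀ e, 0 ≤ s e) ∧
      ((Finset.univ.filter fun e => s e ≠ 0).card : ℝ) ≤ 5 * n / ε ^ 2 ∧
      ∀ x : Fin n → ℝ, (1 - ε) * ∑ e, (b e ⬝ᵥ x) ^ 2 ≤ ∑ e, s e * (b e ⬝ᵥ x) ^ 2 ∧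
        ∑ e, s e * (b e ⬝ᵥ x) ^ 2 ≤ (1 + ε) * ∑ e, (b e ⬝ᵥ x) ^ 2 := by
  classical
  set M : Matrix (Fin n) (Fin n) ℝ := ∑ e, Matrix.vecMulVec (b e) (b e) with hM
  have hH : M.IsHermitian := by
    ext i j
    simp [hM, Matrix.sum_apply, Matrix.vecMulVec_apply, mul_comm]
  obtain ⟨Q, q1, q2, q3⟩ := bss_spectral M hH
  set μ := hH.eigenvalues
  set g : E → Fin n → ℝ := fun e => Q.transpose.mulVec (b e) with hg
  have hgg : ∀ i j, ∑ e, g e i * g e j = Matrix.diagonal μ i j := by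
    intro i j
    have h : Q.transpose * M * Q = Matrix.diagonal μ := by
      rw [q3]
      calc _ = (Q.transpose * Q) * Matrix.diagonal μ * (Q.transpose * Q) := by
            simp only [mul_assoc]
        _ = _ := by rw [q2, one_mul, mul_one]
    rw [← h, hM, Finset.mul_sum, Finset.sum_mul, Matrix.sum_apply]
    refine Finset.sum_congr rfl fun e _ => ?_
    rw [Matrix.mul_vecMulVec, Matrix.vecMulVec_mul, Matrix.vecMulVec_apply,
      ← Matrix.mulVec_transpose]
  have hμ : ∀ i, μ i = ∑ e, g e i ^ 2 := by
    intro i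
    have := hgg i i
    rw [Matrix.diagonal_apply_eq] at this
    rw [← this]
    simp only [sq]
  have hμ0 : ∀ i, 0 ≤ μ i := fun i => by
    rw [hμ]; exact Finset.sum_nonneg fun e _ => sq_nonneg _
  have hgz : ∀ i, μ i = 0 → ∀ e, g e i = 0 := by
    intro i hi e
    rw [hμ, Finset.sum_eq_zero_iff_of_nonneg (fun e _ => sq_nonneg _)] at hi
    exact pow_eq_zero_iff (two_ne_zero) |>.1 (hi e (Finset.mem_univ e))
  let v : E → {i : Fin n // μ i ≠ 0} → ℝ := fun e i => g e i / Real.sqrt (μ i)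
  have hsq : ∀ i : {i : Fin n // μ i ≠ 0}, Real.sqrt (μ i) ≠ 0 := fun i =>
    (Real.sqrt_pos.2 (lt_of_le_of_ne (hμ0 i) (Ne.symm i.2))).ne'
  have hv : ∑ e, Matrix.vecMulVec (v e) (v e) = 1 := by
    ext i j
    rw [Matrix.sum_apply]
    have : ∀ e, Matrix.vecMulVec (v e) (v e) i j =
        g e i * g e j / (Real.sqrt (μ i) * Real.sqrt (μ j)) := by
      intro e; simp only [Matrix.vecMulVec_apply, v]; rw [div_mul_div_comm]
    simp only [this]
    rw [← Finset.sum_div, hgg]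
    by_cases h : i = j
    · subst h
      rw [Matrix.diagonal_apply_eq, Matrix.one_apply_eq, Real.mul_self_sqrt (hμ0 _),
        div_self i.2]
    · rw [Matrix.one_apply_ne h, Matrix.diagonal_apply_ne _ (fun h' => h (Subtype.ext h'))]
      simp
  obtain ⟨s, s0, sc, sq⟩ := bss_main v hv ε h0 h1
  refine ⟨s, s0, sc.trans ?_, ?_⟩
  · have : (Fintype.card {i : Fin n // μ i ≠ 0} : ℝ) ≤ n := by
      have := Fintype.card_subtype_le (fun i : Fin n => μ i ≠ 0)
      rw [Fintype.card_fin] at this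
      exact_mod_cast this
    gcongr
  · intro x
    let y : {i : Fin n // μ i ≠ 0} → ℝ := fun i => Real.sqrt (μ i) * Q.transpose.mulVec x i
    have hy : ∀ e, b e ⬝ᵥ x = v e ⬝ᵥ y := by
      intro e
      have e1 : b e ⬝ᵥ x = g e ⬝ᵥ Q.transpose.mulVec x := by
        rw [hg, Matrix.dotProduct_mulVec, ← Matrix.mulVec_transpose, Matrix.transpose_transpose,
          Matrix.mulVec_mulVec, q1, Matrix.one_mulVec]
      have e2 : v e ⬝ᵥ y = ∑ i : {i : Fin n // μ i ≠ 0}, g e i * Q.transpose.mulVec x i := by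
        refine Finset.sum_congr rfl fun i _ => ?_
        have := hsq i
        simp only [v, y]
        field_simp
      rw [e1, e2, dotProduct,
        ← Finset.sum_subtype (Finset.univ.filter fun i => μ i ≠ 0) (by simp)
          (fun i => g e i * Q.transpose.mulVec x i)]
      symm
      apply Finset.sum_subset (Finset.subset_univ _)
      intro i _ hi
      have : μ i = 0 := by simpa using hi
      rw [hgz i this e, zero_mul]
    have hyy : ∑ e, (v e ⬝ᵥ y) ^ 2 = y ⬝ᵥ y := by
      have := bss_quad v (fun _ => 1) y
      simp only [one_smul, one_mul, hv, Matrix.one_mulVec] at this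
      exact this.symm
    simp only [hy, hyy]
    exact sq y

theorem negLap_eq {n : ℕ} (A : Fin n → Fin n → ℝ) (hs : ∀ i j, A i j = A j i)
    (hz : ∀ i, A i i = 0) (x : Fin n → ℝ) :
    negLapQuad A x = ∑ i, ∑ j, (if i < j then A i j else 0) * (x i + x j) ^ 2 := by
  have e1 : negLapQuad A x = ∑ i, ∑ j, A i j * (x i ^ 2 + x i * x j) := by
    unfold negLapQuad
    refine Finset.sum_congr rfl fun i _ => ?_
    simp only [add_mul, Finset.sum_add_distrib, ite_mul, zero_mul, Finset.sum_ite_eq,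
      Finset.mem_univ, if_true, mul_add]
    congr 1
    · rw [Finset.sum_mul, Finset.sum_mul]
      exact Finset.sum_congr rfl fun j _ => by ring
    · exact Finset.sum_congr rfl fun j _ => by ring
  have e2 : ∑ i, ∑ j, A i j * (x i ^ 2 + x i * x j) =
      ∑ i, ∑ j, (if i < j then A i j else 0) * (x i ^ 2 + x i * x j) +
      ∑ i, ∑ j, (if j < i then A i j else 0) * (x i ^ 2 + x i * x j) := by
    rw [← Finset.sum_add_distrib]
    refine Finset.sum_congr rfl fun i _ => ?_
    rw [← Finset.sum_add_distrib]
    refine Finset.sum_congr rfl fun j _ => ?_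
    rcases lt_trichotomy i j with h | h | h
    · simp [h, h.not_gt]
    · subst h; simp [hz]
    · simp [h, h.not_gt]
  rw [e1, e2, Finset.sum_comm (f := fun i j => (if j < i then A i j else 0) * (x i ^ 2 + x i * x j)),
    ← Finset.sum_add_distrib]
  refine Finset.sum_congr rfl fun i _ => ?_
  rw [← Finset.sum_add_distrib]
  refine Finset.sum_congr rfl fun j _ => ?_
  rw [hs j i]; ring

theorem unCut_eq {n : ℕ} (A : Fin n → Fin n → ℝ) (hs : ∀ i j, A i j = A j i)
    (hz : ∀ i, A i i = 0) (S : Finset (Fin n)) :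
    unCutVal A S = negLapQuad A (fun i => if i ∈ S then 1 else -1) / 4 := by
  rw [negLap_eq A hs hz, unCutVal, Finset.sum_div]
  refine Finset.sum_congr rfl fun i _ => ?_
  rw [Finset.sum_filter, Finset.sum_div]
  refine Finset.sum_congr rfl fun j _ => ?_
  by_cases h : i < j <;> by_cases h1 : i ∈ S <;> by_cases h2 : j ∈ S <;> simp [h, h1, h2] <;> ring

/-- There is a constant `C > 0` such that every undirected weighted
graph `G` on `n` vertices (symmetric nonnegative weight matrix `A` with zero diagonal)
and every `ε ∈ (0,1)` admit a reweighted subgraph `G_ε` (weight matrix `A'` supported on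
the edges of `G`) with at most `C·n/ε²` edges such that
`(1−ε)·xᵀU_G x ≤ xᵀU_{G_ε} x ≤ (1+ε)·xᵀU_G x` for every `x ∈ ℝⁿ`; in particular, `G_ε`
is an `ε`-`unCut`-sparsifier of `G`. -/
theorem stmt18 :
    ∃ C : ℝ, 0 < C ∧
      ∀ (n : ℕ) (A : Fin n → Fin n → ℝ),
        (∀ i j, A i j = A j i) → (∀ i j, 0 ≤ A i j) → (∀ i, A i i = 0) →
        ∀ ε : ℝ, ε ∈ Set.Ioo (0 : ℝ) 1 →
          ∃ A' : Fin n → Fin n → ℝ,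
            (∀ i j, A' i j = A' j i) ∧ (∀ i j, 0 ≤ A' i j) ∧ (∀ i, A' i i = 0) ∧
            (∀ i j, A' i j ≠ 0 → A i j ≠ 0) ∧
            ((Set.ncard {p : Fin n × Fin n | p.1 < p.2 ∧ A' p.1 p.2 ≠ 0} : ℝ) ≤
              C * n / ε ^ 2) ∧
            (∀ x : Fin n → ℝ,
              (1 - ε) * negLapQuad A x ≤ negLapQuad A' x ∧
                negLapQuad A' x ≤ (1 + ε) * negLapQuad A x) ∧
            (∀ S : Finset (Fin n),
              (1 - ε) * unCutVal A S ≤ unCutVal A' S ∧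
                unCutVal A' S ≤ (1 + ε) * unCutVal A S) := by
  refine ⟨5, by norm_num, ?_⟩
  intro n A hs hn hz ε hε
  let w : Fin n × Fin n → ℝ := fun p => if p.1 < p.2 then A p.1 p.2 else 0
  have hw : ∀ p, 0 ≤ w p := by
    intro p; simp only [w]; split_ifs
    · exact hn _ _
    · exact le_rfl
  let b : Fin n × Fin n → Fin n → ℝ := fun p =>
    Real.sqrt (w p) • (Pi.single p.1 1 + Pi.single p.2 1)
  have hb : ∀ p x, (b p ⬝ᵥ x) ^ 2 = w p * (x p.1 + x p.2) ^ 2 := by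
    intro p x
    simp only [b, smul_dotProduct, add_dotProduct, single_one_dotProduct, smul_eq_mul, mul_pow,
      Real.sq_sqrt (hw p)]
  obtain ⟨s, s0, sc, sq⟩ := bss_general n b ε hε.1 hε.2
  let A' : Fin n → Fin n → ℝ := fun i j =>
    if i < j then s (i, j) * A i j else if j < i then s (j, i) * A i j else 0
  have hs' : ∀ i j, A' i j = A' j i := by
    intro i j
    simp only [A']
    rcases lt_trichotomy i j with h | h | h
    · simp [h, h.not_gt, hs i j]
    · subst h; rfl
    · simp [h, h.not_gt, hs i j]
  have hz' : ∀ i, A' i i = 0 := by intro i; simp [A']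
  have hq : ∀ x : Fin n → ℝ, (1 - ε) * negLapQuad A x ≤ negLapQuad A' x ∧
      negLapQuad A' x ≤ (1 + ε) * negLapQuad A x := by
    intro x
    have e1 : negLapQuad A x = ∑ p, (b p ⬝ᵥ x) ^ 2 := by
      rw [negLap_eq A hs hz, Fintype.sum_prod_type]
      simp only [hb, w]
    have e2 : negLapQuad A' x = ∑ p, s p * (b p ⬝ᵥ x) ^ 2 := by
      rw [negLap_eq A' hs' hz', Fintype.sum_prod_type]
      refine Finset.sum_congr rfl fun i _ => Finset.sum_congr rfl fun j _ => ?_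
      simp only [hb, w, A']
      by_cases h : i < j
      · simp only [h, if_true]; ring
      · simp [h]
    rw [e1, e2]
    exact sq x
  refine ⟨A', hs', ?_, hz', ?_, ?_, hq, ?_⟩
  · intro i j
    simp only [A']
    split_ifs
    · exact mul_nonneg (s0 _) (hn _ _)
    · exact mul_nonneg (s0 _) (hn _ _)
    · exact le_rfl
  · intro i j h h0
    apply h
    simp [A', h0]
  · refine le_trans ?_ sc
    have hsub : {p : Fin n × Fin n | p.1 < p.2 ∧ A' p.1 p.2 ≠ 0} ⊆
        ((Finset.univ.filter fun e => s e ≠ 0 : Finset (Fin n × Fin n)) : Set (Fin n × Fin n)) := by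
      rintro p ⟨h1, h2⟩
      simp only [A', h1, if_true] at h2
      simpa using left_ne_zero_of_mul h2
    have := Set.ncard_le_ncard hsub (Finset.finite_toSet _)
    rw [Set.ncard_coe_finset] at this
    exact_mod_cast this
  · intro S
    rw [unCut_eq A hs hz, unCut_eq A' hs' hz']
    obtain ⟨h1, h2⟩ := hq (fun i => if i ∈ S then 1 else -1)
    constructor <;> linarith
end
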